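/- arXiv:2409.01929 — 13 statements merged into one kernel-verified Lean document; each statement's English description precedes it below -/
import Mathlib

section
/- Let D = {f_1, …, f_k} be a set of monic proper divisors of the nonconstant monic polynomial f ∈ 𝔽_q[x]. If the gcd-graph G_f(D) is connected, then gcd(f_1, f_2, …, f_k) = 1. -/
open Polynomial

variable {Fq : Type} [Field Fq] [Fintype Fq] [DecidableEq Fq]

/-- The gcd-graph `G_f(D)`: vertices are `𝔽_q[x]/(f)`, and two distinct vertices are adjacent
iff the (monic, normalized) gcd of a representative of their difference with `f` lies in `D`. -/
def gcdGraph (f : Polynomial Fq) (D : Finset (Polynomial Fq)) :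
    SimpleGraph (AdjoinRoot f) :=
  SimpleGraph.fromRel fun u v =>
    ∃ p : Polynomial Fq, AdjoinRoot.mk f p = u - v ∧ gcd p f ∈ D

/-- If `g` divides every element of `D`, then every vertex reachable from `0` in the gcd-graph
has a representative divisible by `g`. -/
theorem exists_dvd_of_gcdGraph_reachable
    {f g : Polynomial Fq} {D : Finset (Polynomial Fq)} (hg : ∀ d ∈ D, g ∣ d)
    {v : AdjoinRoot f} (h : (gcdGraph f D).Reachable 0 v) :
    ∃ p, AdjoinRoot.mk f p = v ∧ g ∣ p := by
  rw [SimpleGraph.reachable_iff_reflTransGen] at h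
  induction h with
  | refl => exact ⟨0, map_zero _, dvd_zero _⟩
  | tail _ hadj ih =>
    obtain ⟨q, rfl, hq⟩ := ih
    obtain ⟨-, ⟨p, hp, hpD⟩ | ⟨p, hp, hpD⟩⟩ := (SimpleGraph.fromRel_adj _ _ _).1 hadj
    · exact ⟨q - p, by rw [map_sub, hp]; ring,
        dvd_sub hq ((hg _ hpD).trans (gcd_dvd_left _ _))⟩
    · exact ⟨q + p, by rw [map_add, hp]; ring,
        dvd_add hq ((hg _ hpD).trans (gcd_dvd_left _ _))⟩

/-- If the gcd-graph `G_f(D)` is connected, then `gcd(f_1, …, f_k) = 1`. -/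
theorem gcd_eq_one_of_gcdGraph_connected
    (f : Polynomial Fq) (hf : f.Monic) (hdeg : 0 < f.natDegree)
    (D : Finset (Polynomial Fq)) (hD : ∀ d ∈ D, d.Monic ∧ d ∣ f ∧ d ≠ f)
    (hconn : (gcdGraph f D).Connected) :
    D.gcd id = 1 := by
  have hf1 : ¬ f ∣ 1 := fun h => by
    have := natDegree_eq_zero_of_isUnit (isUnit_of_dvd_one h)
    omega
  obtain ⟨q, hq, hgq⟩ := exists_dvd_of_gcdGraph_reachable (g := D.gcd id)
    (fun d hd => Finset.gcd_dvd hd) (hconn.preconnected 0 1)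
  rw [← map_one (AdjoinRoot.mk f), AdjoinRoot.mk_eq_mk] at hq
  obtain rfl | ⟨d, hd⟩ := D.eq_empty_or_nonempty
  · rw [Finset.gcd_empty, zero_dvd_iff] at hgq
    rw [hgq, zero_sub, dvd_neg] at hq
    exact absurd hq hf1
  · have hgf : D.gcd id ∣ f := (Finset.gcd_dvd hd).trans (hD d hd).2.1
    have hg1 : D.gcd id ∣ 1 := (dvd_sub_right hgq).1 (hgf.trans hq)
    rw [← Finset.normalize_gcd, normalize_eq_one]
    exact isUnit_of_dvd_one hg1
end

section
/- Let D = {f_1, …, f_k} be a set of monic proper divisors of the nonconstant monic polynomial f ∈ 𝔽_q[x]. If gcd(f_1, f_2, …, f_k) = 1 and the unitary Cayley graph G_f({1}) is connected, then the gcd-graph G_f(D) is connected. -/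
open Polynomial

variable {Fq : Type} [Field Fq] [Fintype Fq] [DecidableEq Fq]

/-- The differences along which `gcdGraph f D` has edges (together with `0`, if it qualifies). -/
def gcdConnectionSet {K : Type} [Field K] [DecidableEq K]
    (f : Polynomial K) (D : Finset (Polynomial K)) : Set (AdjoinRoot f) :=
  {x | ∃ p : Polynomial K, AdjoinRoot.mk f p = x ∧ gcd p f ∈ D}

theorem gcdGraph_reachable_iff {K : Type} [Field K] [DecidableEq K]
    (f : Polynomial K) (D : Finset (Polynomial K))
    (u v : AdjoinRoot f) :
    (gcdGraph f D).Reachable u v ↔ u - v ∈ AddSubgroup.closure (gcdConnectionSet f D) := by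
  constructor
  · rintro ⟨w⟩
    induction w with
    | nil => simp
    | @cons a b c hab _ ih =>
      have hab' : a - b ∈ AddSubgroup.closure (gcdConnectionSet f D) := by
        rcases ((SimpleGraph.fromRel_adj _ _ _).1 hab).2 with h | h
        · exact AddSubgroup.subset_closure h
        · rw [← neg_sub]
          exact neg_mem (AddSubgroup.subset_closure h)
      simpa using add_mem hab' ih
  · intro h
    have key : ∀ x ∈ AddSubgroup.closure (gcdConnectionSet f D),
        ∀ w, (gcdGraph f D).Reachable (x + w) w := by
      intro x hx
      induction hx using AddSubgroup.closure_induction with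
      | mem x hx =>
        intro w
        by_cases hne : x + w = w
        · rw [hne]
        · refine SimpleGraph.Adj.reachable ((SimpleGraph.fromRel_adj _ _ _).2 ⟨hne, Or.inl ?_⟩)
          simpa [gcdConnectionSet] using hx
      | zero => intro w; rw [zero_add]
      | add x y _ _ hx hy =>
        intro w
        rw [add_assoc]
        exact (hx _).trans (hy w)
      | neg x _ hx =>
        intro w
        simpa using (hx (-x + w)).symm
    simpa using key _ h v

theorem mul_mem_gcdConnectionSet {K : Type} [Field K] [DecidableEq K]
    {f : Polynomial K} {D : Finset (Polynomial K)}
    {r x : AdjoinRoot f} (hr : r ∈ gcdConnectionSet f {1}) (hx : x ∈ gcdConnectionSet f D) :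
    r * x ∈ gcdConnectionSet f D := by
  obtain ⟨s, rfl, hs⟩ := hr
  obtain ⟨p, rfl, hp⟩ := hx
  refine ⟨s * p, map_mul _ _ _, ?_⟩
  have hs : IsCoprime s f := (gcd_isUnit_iff s f).1 (by simp [Finset.mem_singleton.1 hs])
  have hgcd : gcd (s * p) f = gcd p f := by
    refine dvd_antisymm_of_normalize_eq (normalize_gcd _ _) (normalize_gcd _ _) ?_ ?_
    · refine dvd_gcd ?_ (gcd_dvd_right _ _)
      exact (hs.symm.of_isCoprime_of_dvd_left (gcd_dvd_right _ _)).dvd_of_dvd_mul_left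
        (gcd_dvd_left _ _)
    · exact dvd_gcd ((gcd_dvd_left _ _).mul_left _) (gcd_dvd_right _ _)
  rwa [hgcd]

theorem mul_mem_closure_gcdConnectionSet {K : Type} [Field K] [DecidableEq K]
    {f : Polynomial K} {D : Finset (Polynomial K)}
    {r x : AdjoinRoot f} (hr : r ∈ AddSubgroup.closure (gcdConnectionSet f {1}))
    (hx : x ∈ AddSubgroup.closure (gcdConnectionSet f D)) :
    r * x ∈ AddSubgroup.closure (gcdConnectionSet f D) := by
  induction hr using AddSubgroup.closure_induction with
  | mem r hr =>
    induction hx using AddSubgroup.closure_induction with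
    | mem x hx => exact AddSubgroup.subset_closure (mul_mem_gcdConnectionSet hr hx)
    | zero => simp
    | add _ _ _ _ h₁ h₂ => rw [mul_add]; exact add_mem h₁ h₂
    | neg _ _ h => rw [mul_neg]; exact neg_mem h
  | zero => simp
  | add _ _ _ _ h₁ h₂ => rw [add_mul]; exact add_mem h₁ h₂
  | neg _ _ h => rw [neg_mul]; exact neg_mem h

/-- An ideal of `K[X]` containing a finite set contains its gcd. -/
theorem Ideal.finset_gcd_mem {K : Type} [Field K] [DecidableEq K]
    {J : Ideal (Polynomial K)} {D : Finset (Polynomial K)}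
    (h : ∀ d ∈ D, d ∈ J) : D.gcd id ∈ J := by
  rw [← Ideal.span_singleton_generator J, Ideal.mem_span_singleton]
  refine Finset.dvd_gcd fun d hd => ?_
  rw [id, ← Ideal.mem_span_singleton, Ideal.span_singleton_generator]
  exact h d hd

/-- If `gcd(f_1, …, f_k) = 1` and the unitary Cayley graph `G_f({1})` is connected,
then the gcd-graph `G_f(D)` is connected. -/
theorem gcdGraph_connected_of_gcd_eq_one_of_unitary_connected
    (f : Polynomial Fq) (hf : f.Monic) (hdeg : 0 < f.natDegree)
    (D : Finset (Polynomial Fq)) (hD : ∀ d ∈ D, d.Monic ∧ d ∣ f ∧ d ≠ f)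
    (hgcd : D.gcd id = 1)
    (hunit : (gcdGraph f {1}).Connected) :
    (gcdGraph f D).Connected := by
  have htop (r : AdjoinRoot f) : r ∈ AddSubgroup.closure (gcdConnectionSet f {1}) := by
    simpa using (gcdGraph_reachable_iff f {1} r 0).1 (hunit.preconnected r 0)
  let I : Ideal (AdjoinRoot f) :=
    { (AddSubgroup.closure (gcdConnectionSet f D)).toAddSubmonoid with
      smul_mem' := fun r _ hx => mul_mem_closure_gcdConnectionSet (htop r) hx }
  have hmem : ∀ d ∈ D, d ∈ I.comap (AdjoinRoot.mk f) := fun d hd => by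
    obtain ⟨hmonic, hdvd, -⟩ := hD d hd
    refine AddSubgroup.subset_closure ⟨d, rfl, ?_⟩
    rwa [(gcd_eq_left_iff d f hmonic.normalize_eq_self).2 hdvd]
  have hone : (1 : AdjoinRoot f) ∈ I := by
    simpa [hgcd] using Ideal.finset_gcd_mem hmem
  have hI := (Ideal.eq_top_iff_one I).2 hone
  have : Nonempty (AdjoinRoot f) := ⟨0⟩
  refine ⟨fun u v => (gcdGraph_reachable_iff f D u v).2 ?_⟩
  change u - v ∈ I
  simp [hI]
end

section
/- Let D = {f_1, …, f_k} be a set of monic proper divisors of the nonconstant monic polynomial f ∈ 𝔽_q[x]. Suppose that either q ≠ 2, or q = 2 and x(x+1) does not divide f. Then the gcd-graph G_f(D) is connected if and only if gcd(f_1, f_2, …, f_k) = 1. -/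
open Polynomial

variable {Fq : Type} [Field Fq] [Fintype Fq] [DecidableEq Fq]

open UniqueFactorizationMonoid in
/-- In a principal ideal domain, `p` is a sum of two elements coprime to `e` as soon as it is
a sum of two non-multiples of each prime divisor of `e`. -/
theorem exists_isCoprime_and_isCoprime_sub {R : Type*} [CommRing R] [IsDomain R]
    [IsPrincipalIdealRing R] [NormalizationMonoid R] {e : R} (he : e ≠ 0) (p : R)
    (h : ∀ P, Irreducible P → P ∣ e → ∃ u, ¬ P ∣ u ∧ ¬ P ∣ p - u) :
    ∃ u, IsCoprime u e ∧ IsCoprime (p - u) e := by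
  classical
  have hs : ∀ P ∈ (normalizedFactors e).toFinset, P ∈ normalizedFactors e :=
    fun P => Multiset.mem_toFinset.1
  choose! u hu hpu using h
  obtain ⟨y, hy⟩ := IsDedekindDomain.exists_forall_sub_mem_ideal
    (s := (normalizedFactors e).toFinset) (fun P => Ideal.span {P}) (fun _ => 1)
    (fun P hP => Ideal.prime_span_singleton_iff.2 (prime_of_normalized_factor P (hs P hP)))
    (fun P hP Q hQ hPQ hspan => hPQ <| dvd_antisymm_of_normalize_eq
      (normalize_normalized_factor P (hs P hP)) (normalize_normalized_factor Q (hs Q hQ))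
      (Ideal.span_singleton_le_span_singleton.1 hspan.ge)
      (Ideal.span_singleton_le_span_singleton.1 hspan.le))
    (fun P => u P)
  have key : ∀ P, Irreducible P → P ∣ e → ¬ P ∣ y ∧ ¬ P ∣ p - y := by
    intro P hP hPe
    obtain ⟨Q, hQ, hPQ⟩ := exists_mem_normalizedFactors_of_dvd he hP hPe
    have hQirr := irreducible_of_normalized_factor Q hQ
    have hQe := dvd_of_mem_normalizedFactors hQ
    have hyQ : Q ∣ y - u Q := by
      simpa [Ideal.mem_span_singleton] using hy Q (Multiset.mem_toFinset.2 hQ)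
    rw [hPQ.dvd_iff_dvd_left, hPQ.dvd_iff_dvd_left]
    refine ⟨fun hQy => hu Q hQirr hQe ((dvd_sub_right hQy).1 hyQ), fun hQy => ?_⟩
    refine hpu Q hQirr hQe ?_
    simpa using dvd_add hQy hyQ
  refine ⟨y, ?_, ?_⟩
  · exact isCoprime_of_irreducible_dvd (fun h0 => he h0.2) fun P hP hPy hPe => (key P hP hPe).1 hPy
  · exact isCoprime_of_irreducible_dvd (fun h0 => he h0.2) fun P hP hPy hPe => (key P hP hPe).2 hPy

theorem not_dvd_C_mul {K : Type*} [Field K] {P p : K[X]} {c : K} (hc : c ≠ 0) (hp : ¬ P ∣ p) :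
    ¬ P ∣ C c * p := by
  rwa [(Polynomial.isUnit_C.2 hc.isUnit).dvd_mul_left]

/-- If `K` has an element other than `0` and `1`, every polynomial is a sum of two polynomials
coprime to `e`. -/
theorem exists_isCoprime_sub_of_ne {K : Type*} [Field K] [DecidableEq K] {e : K[X]} (he : e ≠ 0)
    {c : K} (hc0 : c ≠ 0) (hc1 : c ≠ 1) (p : K[X]) :
    ∃ u, IsCoprime u e ∧ IsCoprime (p - u) e := by
  refine exists_isCoprime_and_isCoprime_sub he p fun P hP _ => ?_
  by_cases hPp : P ∣ p
  · exact ⟨1, hP.not_dvd_one, fun h => hP.not_dvd_one ((dvd_sub_right hPp).1 h)⟩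
  · refine ⟨C c * p, not_dvd_C_mul hc0 hPp, ?_⟩
    have : p - C c * p = C (1 - c) * p := by simp [sub_mul]
    rw [this]
    exact not_dvd_C_mul (sub_ne_zero.2 hc1.symm) hPp

/-- If each of `X` and `X - 1` divides `p` whenever it divides `e`, then `p` is a sum of two
polynomials coprime to `e`. -/
theorem exists_isCoprime_sub_of_dvd {K : Type*} [Field K] [DecidableEq K] {e p : K[X]}
    (he : e ≠ 0) (h0 : X ∣ e → X ∣ p) (h1 : X - 1 ∣ e → X - 1 ∣ p) :
    ∃ u, IsCoprime u e ∧ IsCoprime (p - u) e := by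
  refine exists_isCoprime_and_isCoprime_sub he p fun P hP hPe => ?_
  by_cases hPp : P ∣ p
  · exact ⟨1, hP.not_dvd_one, fun h => hP.not_dvd_one ((dvd_sub_right hPp).1 h)⟩
  have hX1 : Irreducible (X - 1 : K[X]) := by simpa using irreducible_X_sub_C (1 : K)
  have aux : ∀ Q : K[X], Irreducible Q → (Q ∣ e → Q ∣ p) → ¬ P ∣ Q * p := by
    intro Q hQ hQp hdvd
    have hPQ := hP.associated_of_dvd hQ ((hP.prime.dvd_or_dvd hdvd).resolve_right hPp)
    exact hPp (hPQ.dvd.trans (hQp (hPQ.symm.dvd.trans hPe)))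
  refine ⟨X * p, aux X irreducible_X h0, ?_⟩
  have : p - X * p = -((X - 1) * p) := by ring
  rw [this, dvd_neg]
  exact aux _ hX1 h1

/-- Every polynomial is a sum of polynomials coprime to `e`, unless `q = 2` and
`X * (X + 1) ∣ e`. -/
theorem mem_closure_isCoprime {e : Fq[X]} (he : e ≠ 0)
    (hq : Fintype.card Fq ≠ 2 ∨ (Fintype.card Fq = 2 ∧ ¬ (X * (X + 1) ∣ e))) (p : Fq[X]) :
    p ∈ AddSubgroup.closure {u : Fq[X] | IsCoprime u e} := by
  have of_sub : ∀ p : Fq[X], (∃ u, IsCoprime u e ∧ IsCoprime (p - u) e) →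
      p ∈ AddSubgroup.closure {u : Fq[X] | IsCoprime u e} := by
    rintro p ⟨u, hu, hpu⟩
    rw [← sub_add_cancel p u]
    exact add_mem (AddSubgroup.subset_closure hpu) (AddSubgroup.subset_closure hu)
  by_cases hc : ∃ c : Fq, c ≠ 0 ∧ c ≠ 1
  · obtain ⟨c, hc0, hc1⟩ := hc
    exact of_sub p (exists_isCoprime_sub_of_ne he hc0 hc1 p)
  have hF : ∀ c : Fq, c = 0 ∨ c = 1 := fun c => by
    by_contra h
    exact hc ⟨c, not_or.1 h⟩
  have hcard : Fintype.card Fq = 2 := by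
    have huniv : (Finset.univ : Finset Fq) = {0, 1} := by
      ext c
      simpa using hF c
    rw [← Finset.card_univ, huniv, Finset.card_pair zero_ne_one]
  have hXe : ¬ (X * (X - 1) ∣ e) := by
    have h11 : (-1 : Fq) = 1 := (hF (-1)).resolve_left (by simp)
    have : (X - 1 : Fq[X]) = X + 1 := by
      rw [sub_eq_add_neg, ← C_1, ← C_neg, h11]
    rw [this]
    exact (hq.resolve_left (not_not.2 hcard)).2
  have hcop : IsCoprime (X : Fq[X]) (X - 1) := ⟨1, -1, by ring⟩
  have one_mem : (1 : Fq[X]) ∈ AddSubgroup.closure {u : Fq[X] | IsCoprime u e} :=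
    AddSubgroup.subset_closure isCoprime_one_left
  have dvd_or : ∀ a : Fq, X - C a ∣ p ∨ X - C a ∣ p - 1 := fun a => by
    simpa [dvd_iff_isRoot, sub_eq_zero] using hF (p.eval a)
  by_cases hX : X ∣ e
  · have hX1 : ¬ X - 1 ∣ e := fun h => hXe (hcop.mul_dvd hX h)
    rcases dvd_or 0 with h | h <;> rw [C_0, sub_zero] at h
    · exact of_sub p (exists_isCoprime_sub_of_dvd he (fun _ => h) (fun h => (hX1 h).elim))
    · rw [← sub_add_cancel p 1]
      exact add_mem (of_sub _ (exists_isCoprime_sub_of_dvd he (fun _ => h)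
        (fun h => (hX1 h).elim))) one_mem
  · rcases dvd_or 1 with h | h <;> rw [C_1] at h
    · exact of_sub p (exists_isCoprime_sub_of_dvd he (fun h => (hX h).elim) (fun _ => h))
    · rw [← sub_add_cancel p 1]
      exact add_mem (of_sub _ (exists_isCoprime_sub_of_dvd he (fun h => (hX h).elim)
        (fun _ => h))) one_mem

/-- The differences along which every vertex of a graph on an additive group can be translated
without leaving its connected component. -/
def SimpleGraph.reachableTranslations {V : Type*} [AddCommGroup V] (G : SimpleGraph V) :
    AddSubgroup V where
  carrier := {w | ∀ v, G.Reachable v (v + w)}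
  zero_mem' v := by simp
  add_mem' {a b} ha hb v := by
    rw [← add_assoc]
    exact (ha v).trans (hb (v + a))
  neg_mem' {a} ha v := by
    simpa using (ha (v + -a)).symm

theorem mk_mem_reachableTranslations {K : Type} [Field K] [DecidableEq K] {f : K[X]}
    {D : Finset K[X]} {p : K[X]}
    (hp : gcd p f ∈ D) : AdjoinRoot.mk f p ∈ (gcdGraph f D).reachableTranslations := by
  intro v
  by_cases h0 : AdjoinRoot.mk f p = 0
  · simp [h0]
  · refine SimpleGraph.Adj.reachable ?_
    rw [gcdGraph, SimpleGraph.fromRel_adj]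
    exact ⟨by simpa using h0, Or.inr ⟨p, by simp, hp⟩⟩

theorem gcd_mul_left_eq_of_isCoprime {K : Type*} [Field K] [DecidableEq K] {d e u : K[X]}
    (hd : d.Monic) (hu : IsCoprime u e) : gcd (d * u) (d * e) = d := by
  have h1 : gcd u e = 1 := by
    rw [← normalize_gcd]
    exact normalize_eq_one.2 (gcd_isUnit_iff_isRelPrime.2 hu.isRelPrime)
  rw [gcd_mul_left, hd.normalize_eq_self, h1, mul_one]

theorem mk_mul_mem_reachableTranslations {f : Fq[X]} (hf : f ≠ 0) {D : Finset Fq[X]}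
    (hq : Fintype.card Fq ≠ 2 ∨ (Fintype.card Fq = 2 ∧ ¬ (X * (X + 1) ∣ f))) {d : Fq[X]}
    (hdD : d ∈ D) (hd : d.Monic) (hdf : d ∣ f) (p : Fq[X]) :
    AdjoinRoot.mk f (d * p) ∈ (gcdGraph f D).reachableTranslations := by
  obtain ⟨e, rfl⟩ := hdf
  have hp := mem_closure_isCoprime (right_ne_zero_of_mul hf)
    (hq.imp_right fun h => ⟨h.1, fun hXe => h.2 (hXe.mul_left d)⟩) p
  induction hp using AddSubgroup.closure_induction with
  | mem u hu =>
    exact mk_mem_reachableTranslations (by rwa [gcd_mul_left_eq_of_isCoprime hd hu])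
  | zero => simp
  | add a b _ _ ha hb => rw [mul_add, map_add]; exact add_mem ha hb
  | neg a _ ha => rw [mul_neg, map_neg]; exact neg_mem ha

theorem mk_dvd_sub_of_reachable {K : Type} [Field K] [DecidableEq K] {f : K[X]} {D : Finset K[X]}
    {g : K[X]} (hg : ∀ d ∈ D, g ∣ d) {u v : AdjoinRoot f} (h : (gcdGraph f D).Reachable u v) :
    AdjoinRoot.mk f g ∣ u - v := by
  obtain ⟨w⟩ := h
  have hdvd : ∀ p, gcd p f ∈ D → AdjoinRoot.mk f g ∣ AdjoinRoot.mk f p := fun p hp =>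
    map_dvd _ ((hg _ hp).trans (gcd_dvd_left p f))
  induction w with
  | nil => rw [sub_self]; exact dvd_zero _
  | @cons a b c hab _ ih =>
    rw [gcdGraph, SimpleGraph.fromRel_adj] at hab
    rw [← sub_add_sub_cancel a b c]
    refine dvd_add ?_ ih
    rcases hab.2 with ⟨p, hp, hpD⟩ | ⟨p, hp, hpD⟩
    · rw [← hp]
      exact hdvd p hpD
    · rw [dvd_sub_comm, ← hp]
      exact hdvd p hpD

theorem Finset.span_eq_top_of_gcd_eq_one {R : Type*} [CommRing R] [IsPrincipalIdealRing R]
    [NormalizedGCDMonoid R] {D : Finset R} (h : D.gcd id = 1) : Ideal.span (D : Set R) = ⊤ := by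
  obtain ⟨g, hg⟩ := (IsPrincipalIdealRing.principal (Ideal.span (D : Set R))).principal
  have hg1 : g ∣ D.gcd id := Finset.dvd_gcd fun d hd => by
    have : d ∈ Ideal.span (D : Set R) := Ideal.subset_span hd
    rw [hg] at this
    exact Ideal.mem_span_singleton.1 this
  rw [hg]
  exact Ideal.span_singleton_eq_top.2 (isUnit_of_dvd_one (h ▸ hg1))

/-- If `q ≠ 2`, or `q = 2` and `x(x+1) ∤ f`, then `G_f(D)` is connected iff
`gcd(f_1, …, f_k) = 1`. -/
theorem gcdGraph_connected_iff_gcd_eq_one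
    (f : Polynomial Fq) (hf : f.Monic) (hdeg : 0 < f.natDegree)
    (D : Finset (Polynomial Fq)) (hD : ∀ d ∈ D, d.Monic ∧ d ∣ f ∧ d ≠ f)
    (hq : Fintype.card Fq ≠ 2 ∨ (Fintype.card Fq = 2 ∧ ¬ (X * (X + 1) ∣ f))) :
    (gcdGraph f D).Connected ↔ D.gcd id = 1 := by
  constructor
  · intro hconn
    have h1 := mk_dvd_sub_of_reachable (g := D.gcd id)
      (fun d hd => Finset.gcd_dvd hd) (hconn.preconnected 1 0)
    rw [sub_zero] at h1
    obtain ⟨r, hr⟩ := h1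
    obtain ⟨a, rfl⟩ := AdjoinRoot.mk_surjective r
    rw [← map_mul, ← map_one (AdjoinRoot.mk f), AdjoinRoot.mk_eq_mk] at hr
    have hfu : ¬ IsUnit f := not_isUnit_of_natDegree_pos f hdeg
    have hne : D.Nonempty := by
      rw [Finset.nonempty_iff_ne_empty]
      rintro rfl
      exact hfu (isUnit_of_dvd_one (by simpa using hr))
    obtain ⟨d, hd⟩ := hne
    have hgf : D.gcd id ∣ f := (Finset.gcd_dvd hd).trans (hD d hd).2.1
    rw [← Finset.normalize_gcd]
    exact normalize_eq_one.2 (isUnit_of_dvd_one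
      ((dvd_sub_left (dvd_mul_right _ a)).1 (hgf.trans hr)))
  · intro hgcd
    have hmem : ∀ g ∈ Ideal.span (D : Set Fq[X]), ∀ p,
        AdjoinRoot.mk f (g * p) ∈ (gcdGraph f D).reachableTranslations := by
      intro g hg
      induction hg using Submodule.span_induction with
      | mem d hd =>
        exact mk_mul_mem_reachableTranslations hf.ne_zero hq hd (hD d hd).1 (hD d hd).2.1
      | zero => simp
      | add a b _ _ ha hb =>
        intro p
        rw [add_mul, map_add]
        exact add_mem (ha p) (hb p)
      | smul c a _ ha =>
        intro p
        rw [smul_eq_mul, mul_comm c a, mul_assoc]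
        exact ha (c * p)
    rw [Finset.span_eq_top_of_gcd_eq_one hgcd] at hmem
    refine { preconnected := fun u v => ?_, nonempty := ⟨0⟩ }
    obtain ⟨p, hp⟩ := AdjoinRoot.mk_surjective (v - u)
    have := hmem 1 Submodule.mem_top p u
    rwa [one_mul, hp, add_sub_cancel] at this
end

section
/- Let D = {f_1, …, f_k} be a set of monic proper divisors of the nonconstant monic polynomial f ∈ 𝔽_q[x], and suppose the gcd-graph G_f(D) is connected. If either q ≠ 2, or q = 2 and gcd(x(x+1), f) = 1, then G_f(D) is not a bipartite graph. -/
open Polynomial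

variable {Fq : Type} [Field Fq] [Fintype Fq] [DecidableEq Fq]

theorem IsCoprime.gcd_mul_left_cancel {R : Type*} [CommRing R] [NormalizedGCDMonoid R]
    {a b : R} (h : IsCoprime a b) (p : R) : gcd (a * p) b = gcd p b := by
  refine dvd_antisymm_of_normalize_eq (normalize_gcd _ _) (normalize_gcd _ _)
    (dvd_gcd ?_ (gcd_dvd_right _ _))
    (dvd_gcd ((gcd_dvd_left _ _).mul_left a) (gcd_dvd_right _ _))
  exact (h.of_isCoprime_of_dvd_right (gcd_dvd_right _ _)).symm.dvd_of_dvd_mul_left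
    (gcd_dvd_left _ _)

theorem gcdGraph_adj_of_mk_eq_sub {K : Type} [Field K] [DecidableEq K] {f : K[X]}
    {D : Finset K[X]} {p : K[X]} {u v : AdjoinRoot f} (hp : ¬ f ∣ p) (hD : gcd p f ∈ D)
    (huv : AdjoinRoot.mk f p = u - v) : (gcdGraph f D).Adj u v := by
  refine (SimpleGraph.fromRel_adj _ _ _).2 ⟨fun h => hp ?_, Or.inl ⟨p, huv, hD⟩⟩
  rw [← AdjoinRoot.mk_eq_zero, huv, h, sub_self]

theorem exists_gcd_mem_of_gcdGraph_adj {K : Type} [Field K] [DecidableEq K] {f : K[X]}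
    {D : Finset K[X]} {u v : AdjoinRoot f} (h : (gcdGraph f D).Adj u v) :
    ∃ p : K[X], ¬ f ∣ p ∧ gcd p f ∈ D := by
  obtain ⟨hne, ⟨p, hp, hD⟩ | ⟨p, hp, hD⟩⟩ := (SimpleGraph.fromRel_adj _ _ _).1 h <;>
    refine ⟨p, ?_, hD⟩ <;> rw [← AdjoinRoot.mk_eq_zero, hp, sub_eq_zero]
  exacts [hne, hne.symm]

/-- If `a` and `1 + a` are units modulo `f`, then an edge of `G_f(D)` gives rise to a triangle. -/
theorem gcdGraph_not_cliqueFree_three {K : Type} [Field K] [DecidableEq K] {f a : K[X]}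
    {D : Finset K[X]} {u v : AdjoinRoot f} (h : (gcdGraph f D).Adj u v)
    (ha : IsCoprime a f) (ha' : IsCoprime (1 + a) f) : ¬ (gcdGraph f D).CliqueFree 3 := by
  classical
  obtain ⟨p, hp, hD⟩ := exists_gcd_mem_of_gcdGraph_adj h
  have adj_of_unit {b : K[X]} (hb : IsCoprime b f) {x y : AdjoinRoot f}
      (hxy : AdjoinRoot.mk f (b * p) = x - y) : (gcdGraph f D).Adj x y :=
    gcdGraph_adj_of_mk_eq_sub (fun hd => hp (hb.symm.dvd_of_dvd_mul_left hd))
      (by rwa [hb.gcd_mul_left_cancel]) hxy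
  refine fun hfree => hfree {AdjoinRoot.mk f ((1 + a) * p), AdjoinRoot.mk f p, 0}
    (SimpleGraph.is3Clique_triple_iff.2 ⟨adj_of_unit ha ?_, adj_of_unit ha' ?_,
      adj_of_unit isCoprime_one_left ?_⟩)
  · rw [← map_sub]; ring_nf
  · rw [sub_zero]
  · rw [sub_zero, one_mul]

/-- A finite field with more than two elements has two units differing by `1`, and `X`, `X + 1`
serve the same purpose over the field with two elements. -/
theorem exists_isCoprime_and_isCoprime_one_add {K : Type} [Field K] [Fintype K] [DecidableEq K]
    (f : K[X]) (hq : Fintype.card K ≠ 2 ∨ (Fintype.card K = 2 ∧ gcd (X * (X + 1)) f = 1)) :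
    ∃ a : K[X], IsCoprime a f ∧ IsCoprime (1 + a) f := by
  rcases hq with hq | ⟨-, hgcd⟩
  · have hcard : 2 < Fintype.card K := by
      have := Fintype.one_lt_card (α := K)
      omega
    obtain ⟨c, hc⟩ : ∃ c : K, c ∉ ({0, -1} : Finset K) := by
      by_contra! hall
      have hle := Finset.card_le_card (fun c _ => hall c : Finset.univ ⊆ ({0, -1} : Finset K))
      have := Finset.card_le_two (a := (0 : K)) (b := -1)
      rw [Finset.card_univ] at hle
      omega
    simp only [Finset.mem_insert, Finset.mem_singleton, not_or] at hc
    have isCoprime_C {d : K} (hd : d ≠ 0) : IsCoprime (C d) f :=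
      isCoprime_one_left.of_isCoprime_of_dvd_left (isUnit_C.2 hd.isUnit).dvd
    refine ⟨C c, isCoprime_C hc.1, ?_⟩
    rw [← C_1, ← C_add]
    exact isCoprime_C fun h => hc.2 (eq_neg_of_add_eq_zero_right h)
  · have hcop : IsCoprime (X * (X + 1)) f := (gcd_isUnit_iff _ _).1 (by simp [hgcd])
    exact ⟨X, hcop.of_mul_left_left, add_comm X (1 : K[X]) ▸ hcop.of_mul_left_right⟩

/-- If `G_f(D)` is connected and either `q ≠ 2`, or `q = 2` and `gcd(x(x+1), f) = 1`,
then `G_f(D)` is not bipartite (i.e. not 2-colorable). -/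
theorem gcdGraph_not_bipartite
    (f : Polynomial Fq) (hf : f.Monic) (hdeg : 0 < f.natDegree)
    (D : Finset (Polynomial Fq)) (hD : ∀ d ∈ D, d.Monic ∧ d ∣ f ∧ d ≠ f)
    (hconn : (gcdGraph f D).Connected)
    (hq : Fintype.card Fq ≠ 2 ∨ (Fintype.card Fq = 2 ∧ gcd (X * (X + 1)) f = 1)) :
    ¬ (gcdGraph f D).Colorable 2 := by
  have := AdjoinRoot.nontrivial f (natDegree_pos_iff_degree_pos.1 hdeg).ne'
  obtain ⟨u, hu⟩ := hconn.preconnected.exists_adj_of_nontrivial 0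
  obtain ⟨a, ha, ha'⟩ := exists_isCoprime_and_isCoprime_one_add f hq
  exact fun hcol => gcdGraph_not_cliqueFree_three hu ha ha' (hcol.cliqueFree (by norm_num))
end

section
/- Suppose 𝔽_q = 𝔽_2 and let f ∈ 𝔽_2[x] be a nonconstant monic polynomial with g_0 := gcd(x(x+1), f) ∉ {1, x(x+1)} (i.e. exactly one of x, x+1 divides f). Let D = {f_1, …, f_k} be a set of monic proper divisors of f such that the gcd-graph G_f(D) is connected. Then G_f(D) is bipartite if and only if g_0 does not divide f_i for all 1 ≤ i ≤ k. -/
open Polynomial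

variable {Fq : Type} [Field Fq] [Fintype Fq] [DecidableEq Fq]

theorem ZMod.polynomial_eq_of_dvd_dvd {p q : (ZMod 2)[X]} (hpq : p ∣ q) (hqp : q ∣ p) :
    p = q := by
  have monic : ∀ r : (ZMod 2)[X], r ≠ 0 → r.Monic := fun r hr =>
    (by decide : ∀ a : ZMod 2, a ≠ 0 → a = 1) _ (leadingCoeff_ne_zero.mpr hr)
  rcases eq_or_ne p 0 with rfl | hp
  · exact (zero_dvd_iff.mp hpq).symm
  · have hq : q ≠ 0 := by
      rintro rfl
      exact hp (zero_dvd_iff.mp hqp)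
    exact eq_of_monic_of_associated (monic p hp) (monic q hq) (associated_of_dvd_dvd hpq hqp)

theorem gcd_mul_eq_left_of_coprime {f p q : (ZMod 2)[X]} (hp : p ∣ f) (hq : IsCoprime q f) :
    gcd (p * q) f = p := by
  refine ZMod.polynomial_eq_of_dvd_dvd ?_ (dvd_gcd (dvd_mul_right p q) hp)
  have h : IsCoprime (gcd (p * q) f) q := (hq.of_isCoprime_of_dvd_right (gcd_dvd_right _ _)).symm
  exact h.dvd_of_dvd_mul_right (gcd_dvd_left _ _)

theorem gcd_mul_left_eq_of_coprime {f p q : (ZMod 2)[X]} (hq : IsCoprime q f) :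
    gcd (q * p) f = gcd p f := by
  refine ZMod.polynomial_eq_of_dvd_dvd (dvd_gcd ?_ (gcd_dvd_right _ _))
    (dvd_gcd ((gcd_dvd_left _ _).mul_left q) (gcd_dvd_right _ _))
  have h : IsCoprime (gcd (q * p) f) q := (hq.of_isCoprime_of_dvd_right (gcd_dvd_right _ _)).symm
  exact h.dvd_of_dvd_mul_left (gcd_dvd_left _ _)

theorem exists_gcd_X_mul_X_add_one_eq {f : (ZMod 2)[X]}
    (hg0 : gcd (X * (X + 1)) f ≠ 1) (hg0' : gcd (X * (X + 1)) f ≠ X * (X + 1)) :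
    ∃ a : ZMod 2, gcd (X * (X + 1)) f = X - C a ∧ f.IsRoot a ∧
      IsCoprime (X - C a + 1) f := by
  have h1 : (X - C 1 : (ZMod 2)[X]) = X + 1 := by
    rw [CharTwo.sub_eq_add, C_1]
  have h2 : (X + 1 + 1 : (ZMod 2)[X]) = X := by
    rw [add_assoc, CharTwo.add_self_eq_zero, add_zero]
  have hX1 : Irreducible (X + 1 : (ZMod 2)[X]) := h1 ▸ irreducible_X_sub_C 1
  have hco : IsCoprime (X : (ZMod 2)[X]) (X + 1) := ⟨-1, 1, by ring⟩
  by_cases hx : (X : (ZMod 2)[X]) ∣ f <;> by_cases hy : (X + 1 : (ZMod 2)[X]) ∣ f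
  · exact absurd (ZMod.polynomial_eq_of_dvd_dvd (gcd_dvd_left _ _)
      (dvd_gcd dvd_rfl (hco.mul_dvd hx hy))) hg0'
  · have hc := (hX1.coprime_iff_not_dvd).mpr hy
    refine ⟨0, ?_, ?_, ?_⟩
    · simpa using gcd_mul_eq_left_of_coprime hx hc
    · exact dvd_iff_isRoot.mp (by simpa using hx)
    · simpa using hc
  · have hc := (irreducible_X.coprime_iff_not_dvd).mpr hx
    refine ⟨1, ?_, ?_, ?_⟩
    · rw [h1, mul_comm]
      exact gcd_mul_eq_left_of_coprime hy hc
    · exact dvd_iff_isRoot.mp (by rwa [h1])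
    · rwa [h1, h2]
  · have hc := ((irreducible_X.coprime_iff_not_dvd).mpr hx).mul_left
      ((hX1.coprime_iff_not_dvd).mpr hy)
    exact absurd (by simpa using gcd_mul_eq_left_of_coprime (one_dvd f) hc) hg0

theorem gcdGraph_adj_iff {f : (ZMod 2)[X]} {D : Finset (ZMod 2)[X]} (hfD : f ∉ D)
    {u v : AdjoinRoot f} :
    (gcdGraph f D).Adj u v ↔ ∃ p : (ZMod 2)[X], AdjoinRoot.mk f p = u - v ∧ gcd p f ∈ D := by
  rw [gcdGraph, SimpleGraph.fromRel_adj]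
  constructor
  · rintro ⟨-, h | ⟨p, hp, hpD⟩⟩
    · exact h
    · refine ⟨p, ?_, hpD⟩
      rw [← CharTwo.neg_eq p, map_neg, hp, neg_sub]
  · rintro ⟨p, hp, hpD⟩
    refine ⟨?_, Or.inl ⟨p, hp, hpD⟩⟩
    rintro rfl
    rw [sub_self, AdjoinRoot.mk_eq_zero] at hp
    rw [ZMod.polynomial_eq_of_dvd_dvd (gcd_dvd_right p f) (dvd_gcd hp dvd_rfl)] at hpD
    exact hfD hpD

theorem gcdGraph_adj_mul_add {f : (ZMod 2)[X]} {D : Finset (ZMod 2)[X]} (hfD : f ∉ D)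
    {q : (ZMod 2)[X]} (hq : IsCoprime q f) (w : AdjoinRoot f) {u v : AdjoinRoot f}
    (h : (gcdGraph f D).Adj u v) :
    (gcdGraph f D).Adj (AdjoinRoot.mk f q * u + w) (AdjoinRoot.mk f q * v + w) := by
  rw [gcdGraph_adj_iff hfD] at h ⊢
  obtain ⟨p, hp, hpD⟩ := h
  refine ⟨q * p, ?_, ?_⟩
  · rw [map_mul, hp]
    ring
  · rwa [gcd_mul_left_eq_of_coprime hq]

/-- The colours at two vertices agree along the images of a walk under any two graph
endomorphisms that agree in colour at its start. -/
theorem SimpleGraph.Coloring.eq_of_reachable {V W : Type*} {G : SimpleGraph V}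
    {H : SimpleGraph W} (c : H.Coloring (Fin 2)) (φ ψ : G →g H) {u v : V}
    (huv : G.Reachable u v) (h : c (φ u) = c (ψ u)) : c (φ v) = c (ψ v) := by
  obtain ⟨p⟩ := huv
  induction p with
  | nil => exact h
  | cons hadj _ ih =>
    refine ih ?_
    have h1 := c.valid (φ.map_adj hadj)
    have h2 := c.valid (ψ.map_adj hadj)
    omega

/-- Over `𝔽_2`, with `g₀ = gcd(x(x+1), f) ∉ {1, x(x+1)}` and `G_f(D)` connected:
`G_f(D)` is bipartite iff `g₀ ∤ f_i` for all `i`. -/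
theorem gcdGraph_bipartite_iff_of_gcd_ne
    (f : Polynomial (ZMod 2)) (hf : f.Monic) (hdeg : 0 < f.natDegree)
    (hg0 : gcd (X * (X + 1)) f ≠ 1) (hg0' : gcd (X * (X + 1)) f ≠ X * (X + 1))
    (D : Finset (Polynomial (ZMod 2))) (hD : ∀ d ∈ D, d.Monic ∧ d ∣ f ∧ d ≠ f)
    (hconn : (gcdGraph f D).Connected) :
    (gcdGraph f D).Colorable 2 ↔ ∀ d ∈ D, ¬ gcd (X * (X + 1)) f ∣ d := by
  have hfD : f ∉ D := fun h => (hD f h).2.2 rfl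
  obtain ⟨a, hg, hroot, hcop⟩ := exists_gcd_X_mul_X_add_one_eq hg0 hg0'
  rw [hg]
  constructor
  · rintro ⟨c⟩ d hd ⟨z, rfl⟩
    let shift (q : (ZMod 2)[X]) (hq : IsCoprime q f) : gcdGraph f D →g gcdGraph f D :=
      ⟨fun y => AdjoinRoot.mk f q * y + AdjoinRoot.mk f (-z),
        fun h => gcdGraph_adj_mul_add hfD hq _ h⟩
    have key := c.eq_of_reachable (shift _ hcop) (shift 1 isCoprime_one_left)
      (hconn.preconnected 0 (AdjoinRoot.mk f z)) (by simp [shift])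
    refine c.valid ((gcdGraph_adj_iff hfD).mpr ⟨(X - C a) * z, ?_, ?_⟩) key
    · change _ = (AdjoinRoot.mk f _ * _ + _) - (AdjoinRoot.mk f _ * _ + _)
      simp only [← map_mul, ← map_add, ← map_sub]
      congr 1
      ring
    · rwa [ZMod.polynomial_eq_of_dvd_dvd (gcd_dvd_left _ f) (dvd_gcd dvd_rfl (hD _ hd).2.1)]
  · intro h
    let ev : AdjoinRoot f →+* ZMod 2 :=
      AdjoinRoot.lift (RingHom.id (ZMod 2)) a (by simpa [eval₂_id] using hroot)
    refine (SimpleGraph.Coloring.mk (G := gcdGraph f D) ev ?_).colorable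
    intro u v huv he
    obtain ⟨p, hp, hpD⟩ := (gcdGraph_adj_iff hfD).mp huv
    refine h _ hpD (dvd_gcd (dvd_iff_isRoot.mpr ?_) (dvd_iff_isRoot.mpr hroot))
    have := congrArg ev hp
    rw [map_sub, he, sub_self, AdjoinRoot.lift_mk] at this
    exact this
end

section
/- Suppose 𝔽_q = 𝔽_2 and x(x+1) divides the nonconstant monic polynomial f ∈ 𝔽_2[x]. Let D = {f_1, …, f_k} be a set of monic proper divisors of f such that the gcd-graph G_f(D) is connected, and let D̄ = {gcd(f_i, x(x+1)) : 1 ≤ i ≤ k}. Then G_f(D) is bipartite if and only if |D̄| = 2. -/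
open Polynomial

variable {Fq : Type} [Field Fq] [Fintype Fq] [DecidableEq Fq]

theorem Polynomial.eq_of_dvd_of_dvd_zmod_two {p q : (ZMod 2)[X]} (h₁ : p ∣ q) (h₂ : q ∣ p) :
    p = q := by
  obtain ⟨u, rfl⟩ := associated_of_dvd_dvd h₁ h₂
  obtain ⟨r, hr, hu⟩ := Polynomial.isUnit_iff.1 u.isUnit
  have hr1 : r = 1 := by
    have h2 : ∀ r : ZMod 2, r ≠ 0 → r = 1 := by decide
    exact h2 r hr.ne_zero
  rw [← hu, hr1, C_1, mul_one]

/-- The values of a polynomial over `𝔽_2` at `0` and `1`. -/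
def zmodTwoEvals (p : (ZMod 2)[X]) : ZMod 2 × ZMod 2 := (p.eval 0, p.eval 1)

theorem zmodTwo_eq_iff_eq_zero_iff : ∀ a b : ZMod 2, a = b ↔ (a = 0 ↔ b = 0) := by
  decide

theorem zmodTwo_X_add_one : (X + 1 : (ZMod 2)[X]) = X - C 1 := by
  rw [C_1, CharTwo.sub_eq_add]

theorem zmodTwoEvals_gcd (p q : (ZMod 2)[X]) (hq : X * (X + 1) ∣ q) :
    zmodTwoEvals (gcd p q) = zmodTwoEvals p := by
  have key : ∀ a : ZMod 2, X - C a ∣ q → (gcd p q).eval a = p.eval a := fun a ha => by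
    rw [zmodTwo_eq_iff_eq_zero_iff]
    change IsRoot _ _ ↔ IsRoot _ _
    rw [← dvd_iff_isRoot, ← dvd_iff_isRoot, dvd_gcd_iff]
    exact and_iff_left ha
  refine Prod.ext (key 0 ?_) (key 1 ?_)
  · rw [C_0, sub_zero]
    exact (dvd_mul_right _ _).trans hq
  · rw [← zmodTwo_X_add_one]
    exact (dvd_mul_left _ _).trans hq

theorem exists_eq_of_zmodTwoEvals (p : (ZMod 2)[X]) :
    ∃ r, p = C (p.eval 0) * (X + 1) + C (p.eval 1) * X + X * (X + 1) * r := by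
  obtain ⟨s, hs⟩ := X_sub_C_dvd_sub_C_eval (a := 0) (p := p)
  obtain ⟨r, hr⟩ := X_sub_C_dvd_sub_C_eval (a := 1) (p := s)
  have h1 : p.eval 1 = p.eval 0 + s.eval 1 := by
    have := congrArg (eval 1) hs
    simp only [eval_sub, eval_C, eval_mul, eval_X, sub_zero, one_mul] at this
    rw [← this]; ring
  refine ⟨r, ?_⟩
  rw [h1, C_add, zmodTwo_X_add_one]
  rw [C_0, sub_zero] at hs
  have h2 : (2 : (ZMod 2)[X]) = 0 := CharTwo.two_eq_zero
  have h3 : (C 1 : (ZMod 2)[X]) = 1 := C_1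
  linear_combination hs + X * hr - C (eval 0 p) * (X - 1) * h2 + C (eval 0 p) * h3

theorem gcd_eq_gcd_of_zmodTwoEvals_eq {p q : (ZMod 2)[X]} (h : zmodTwoEvals p = zmodTwoEvals q) :
    gcd p (X * (X + 1)) = gcd q (X * (X + 1)) := by
  obtain ⟨h0, h1⟩ := Prod.ext_iff.1 h
  simp only [zmodTwoEvals] at h0 h1
  obtain ⟨r, hr⟩ := exists_eq_of_zmodTwoEvals p
  obtain ⟨s, hs⟩ := exists_eq_of_zmodTwoEvals q
  have hpq : p - q = X * (X + 1) * (r - s) := by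
    rw [h0, h1] at hr
    linear_combination hr - hs
  have hd : X * (X + 1) ∣ p - q := ⟨_, hpq⟩
  refine eq_of_dvd_of_dvd_zmod_two (dvd_gcd ?_ (gcd_dvd_right _ _))
    (dvd_gcd ?_ (gcd_dvd_right _ _))
  · exact (dvd_iff_dvd_of_dvd_sub ((gcd_dvd_right _ _).trans hd)).1 (gcd_dvd_left _ _)
  · exact (dvd_iff_dvd_of_dvd_sub ((gcd_dvd_right _ _).trans hd)).2 (gcd_dvd_left _ _)

theorem card_image_gcd_eq_card_image_zmodTwoEvals (D : Finset (ZMod 2)[X]) :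
    (D.image fun d => gcd d (X * (X + 1))).card = (D.image zmodTwoEvals).card := by
  have h : D.image zmodTwoEvals = (D.image fun d => gcd d (X * (X + 1))).image zmodTwoEvals := by
    rw [Finset.image_image]
    exact Finset.image_congr fun d _ => (zmodTwoEvals_gcd d _ dvd_rfl).symm
  rw [h]
  refine (Finset.card_image_of_injOn ?_).symm
  intro a ha b hb hde
  obtain ⟨d, -, rfl⟩ := Finset.mem_image.1 ha
  obtain ⟨e, -, rfl⟩ := Finset.mem_image.1 hb
  simp only [zmodTwoEvals_gcd _ _ dvd_rfl] at hde
  exact gcd_eq_gcd_of_zmodTwoEvals_eq hde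

/-- Modulo any nonzero `f`, a multiple of `x(x+1)` is a sum of two units. -/
theorem exists_isCoprime_isCoprime_sub (a : (ZMod 2)[X]) (ha : X * (X + 1) ∣ a)
    (f : (ZMod 2)[X]) (hf : f ≠ 0) : ∃ u, IsCoprime u f ∧ IsCoprime (a - u) f := by
  induction f using UniqueFactorizationMonoid.induction_on_coprime with
  | h0 => exact absurd rfl hf
  | h1 hu =>
    obtain ⟨v, hv⟩ := hu.exists_left_inv
    exact ⟨0, ⟨0, v, by rw [hv, zero_mul, zero_add]⟩, ⟨0, v, by rw [hv, zero_mul, zero_add]⟩⟩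
  | hpr n hp =>
    rename_i p
    have cop : ∀ {b : (ZMod 2)[X]}, ¬ p ∣ b → IsCoprime b (p ^ n) := fun h =>
      ((hp.irreducible.coprime_iff_not_dvd.2 h).symm).pow_right
    have h1 : ¬ p ∣ 1 := fun h => hp.not_isUnit (isUnit_of_dvd_one h)
    by_cases hpa : p ∣ a
    · exact ⟨1, cop h1, cop fun h => h1 ((dvd_sub_right hpa).1 h)⟩
    by_cases hpa1 : p ∣ a - 1
    · refine ⟨X, cop fun h => hpa ((h.mul_right _).trans ha), cop fun h => hpa ?_⟩
      refine Dvd.dvd.trans (Dvd.dvd.mul_left ?_ _) ha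
      have := dvd_sub h hpa1
      rw [CharTwo.sub_eq_add, CharTwo.sub_eq_add, CharTwo.sub_eq_add] at this
      convert this using 1
      linear_combination - a * (CharTwo.two_eq_zero : (2 : (ZMod 2)[X]) = 0)
    · exact ⟨1, cop h1, cop hpa1⟩
  | hcp hxy ihx ihy =>
    rename_i x y
    obtain ⟨u, hu, hu'⟩ := ihx (left_ne_zero_of_mul hf)
    obtain ⟨v, hv, hv'⟩ := ihy (right_ne_zero_of_mul hf)
    obtain ⟨b, c, hbc⟩ := hxy.isCoprime
    have ex : u * (c * y) + v * (b * x) = u + x * (b * (v - u)) := by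
      linear_combination u * hbc
    have ey : u * (c * y) + v * (b * x) = v + y * (c * (u - v)) := by
      linear_combination v * hbc
    refine ⟨u * (c * y) + v * (b * x), .mul_right ?_ ?_, .mul_right ?_ ?_⟩
    · rw [ex]; exact hu.add_mul_left_left _
    · rw [ey]; exact hv.add_mul_left_left _
    · rw [ex, ← sub_sub, sub_eq_add_neg, ← mul_neg]; exact hu'.add_mul_left_left _
    · rw [ey, ← sub_sub, sub_eq_add_neg, ← mul_neg]; exact hv'.add_mul_left_left _

theorem gcd_mul_eq_of_isCoprime {d f u : (ZMod 2)[X]} (hd : d ∣ f) (hu : IsCoprime u f) :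
    gcd (d * u) f = d := by
  refine eq_of_dvd_of_dvd_zmod_two ?_ (dvd_gcd (dvd_mul_right _ _) hd)
  exact (hu.symm.of_isCoprime_of_dvd_left (gcd_dvd_right _ _)).dvd_of_dvd_mul_right
    (gcd_dvd_left _ _)

/-- The connection set of a connected gcd-graph generates the quotient ring additively. -/
theorem eq_top_of_gcdGraph_connected {f : (ZMod 2)[X]} {D : Finset (ZMod 2)[X]}
    (hconn : (gcdGraph f D).Connected) (H : AddSubgroup (AdjoinRoot f))
    (hH : ∀ p, gcd p f ∈ D → AdjoinRoot.mk f p ∈ H) : H = ⊤ := by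
  have step : ∀ u v, (gcdGraph f D).Adj u v → u - v ∈ H := by
    rintro u v ⟨-, ⟨p, hp, hpD⟩ | ⟨p, hp, hpD⟩⟩
    · exact hp ▸ hH p hpD
    · rw [H.sub_mem_comm_iff]
      exact hp ▸ hH p hpD
  have walk : ∀ u v, (gcdGraph f D).Walk u v → u - v ∈ H := by
    intro u v w
    induction w with
    | nil => simp
    | cons h _ ih => simpa using H.add_mem (step _ _ h) ih
  refine eq_top_iff.2 fun a _ => ?_
  obtain ⟨w⟩ := hconn.preconnected a 0
  simpa using walk _ _ w

theorem gcdGraph_adj_add {f : (ZMod 2)[X]} {D : Finset (ZMod 2)[X]}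
    (hD : f ∉ D) {p : (ZMod 2)[X]} (hp : gcd p f ∈ D) (u : AdjoinRoot f) :
    (gcdGraph f D).Adj (u + AdjoinRoot.mk f p) u := by
  refine ⟨fun h => hD ?_, Or.inl ⟨p, by simp, hp⟩⟩
  have h0 : AdjoinRoot.mk f p = 0 := by simpa using h
  rw [AdjoinRoot.mk_eq_zero] at h0
  rwa [eq_of_dvd_of_dvd_zmod_two (gcd_dvd_right p f) (dvd_gcd h0 dvd_rfl)] at hp

theorem exists_hom_of_colorable {f : (ZMod 2)[X]} {D : Finset (ZMod 2)[X]}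
    (hD : f ∉ D) (hconn : (gcdGraph f D).Connected)
    (hcol : (gcdGraph f D).Colorable 2) :
    ∃ χ : AdjoinRoot f →+ ZMod 2, ∀ p, gcd p f ∈ D → χ (AdjoinRoot.mk f p) = 1 := by
  obtain ⟨c⟩ := hcol
  let c' : AdjoinRoot f → ZMod 2 := c
  have hne : ∀ a b : ZMod 2, a ≠ b → a = b + 1 := by decide
  have hc : ∀ p, gcd p f ∈ D → ∀ u, c' (u + AdjoinRoot.mk f p) = c' u + 1 := fun p hp u =>
    hne _ _ (c.valid (gcdGraph_adj_add hD hp u))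
  let H : AddSubgroup (AdjoinRoot f) :=
    { carrier := {a | ∃ k, ∀ u, c' (u + a) = c' u + k}
      zero_mem' := ⟨0, by simp⟩
      add_mem' := by
        rintro a b ⟨k, hk⟩ ⟨l, hl⟩
        exact ⟨k + l, fun u => by rw [← add_assoc, hl, hk, add_assoc]⟩
      neg_mem' := by
        rintro a ⟨k, hk⟩
        refine ⟨-k, fun u => ?_⟩
        have := hk (u + -a)
        rw [neg_add_cancel_right] at this
        rw [this, add_neg_cancel_right] }
  have hH : H = ⊤ := eq_top_of_gcdGraph_connected hconn H fun p hp => ⟨1, hc p hp⟩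
  have hall : ∀ a, ∃ k, ∀ u, c' (u + a) = c' u + k := fun a =>
    (hH ▸ AddSubgroup.mem_top a : a ∈ H)
  choose k hk using hall
  refine ⟨AddMonoidHom.mk' k fun a b => ?_, fun p hp => ?_⟩
  · have := hk (a + b) 0
    rw [← add_assoc, hk b, hk a, add_assoc] at this
    exact (add_left_cancel this).symm
  · exact add_left_cancel ((hk _ 0).symm.trans (hc p hp 0))

theorem hom_mul_eq_zero {f : (ZMod 2)[X]} {D : Finset (ZMod 2)[X]} (hf : f.Monic)
    (hconn : (gcdGraph f D).Connected) (χ : AdjoinRoot f →+ ZMod 2)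
    (hχ : ∀ p, gcd p f ∈ D → χ (AdjoinRoot.mk f p) = 1) (r : (ZMod 2)[X]) :
    χ (AdjoinRoot.mk f (X * (X + 1) * r)) = 0 := by
  let K : AddSubgroup (AdjoinRoot f) :=
    { carrier := {a | ∀ w, χ (a * (AdjoinRoot.mk f (X * (X + 1)) * w)) = 0}
      zero_mem' := by simp
      add_mem' := fun ha hb w => by rw [add_mul, map_add, ha, hb, add_zero]
      neg_mem' := fun ha w => by rw [neg_mul, map_neg, ha, neg_zero] }
  have hK : K = ⊤ := by
    refine eq_top_of_gcdGraph_connected hconn K fun p hp w => ?_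
    obtain ⟨w, rfl⟩ := AdjoinRoot.mk_surjective w
    obtain ⟨t, ht⟩ := gcd_dvd_left p f
    obtain ⟨u, hu, hv⟩ := exists_isCoprime_isCoprime_sub (X * (X + 1) * (t * w))
      (dvd_mul_right _ _) f hf.ne_zero
    have hd := gcd_dvd_right p f
    generalize gcd p f = d at *
    have e : AdjoinRoot.mk f p * (AdjoinRoot.mk f (X * (X + 1)) * AdjoinRoot.mk f w) =
        AdjoinRoot.mk f (d * u) + AdjoinRoot.mk f (d * (X * (X + 1) * (t * w) - u)) := by
      rw [← map_mul, ← map_mul, ← map_add, ht]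
      congr 1
      ring
    rw [e, map_add, hχ _ (by rwa [gcd_mul_eq_of_isCoprime hd hu]),
      hχ _ (by rwa [gcd_mul_eq_of_isCoprime hd hv])]
    exact CharTwo.add_self_eq_zero 1
  have h1 : (1 : AdjoinRoot f) ∈ K := hK ▸ AddSubgroup.mem_top _
  simpa using h1 (AdjoinRoot.mk f r)

theorem zmodTwo_finset_card_eq_two_iff : ∀ T : Finset (ZMod 2 × ZMod 2),
    (∀ α β : ZMod 2, (∀ t ∈ T, α * t.1 + β * t.2 = 0) → α = 0 ∧ β = 0) →
      ((∃ α β : ZMod 2, ∀ t ∈ T, α * t.1 + β * t.2 = 1) ↔ T.card = 2) := by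
  decide

/-- The additive map `p ↦ α p(0) + β p(1)` on `𝔽_2[x]/(f)`. -/
noncomputable def evalHom {f : (ZMod 2)[X]} (hxx : X * (X + 1) ∣ f) (α β : ZMod 2) :
    AdjoinRoot f →+ ZMod 2 :=
  (AddMonoidHom.mulLeft α).comp (AdjoinRoot.lift (RingHom.id _) 0 (by
    obtain ⟨g, rfl⟩ := hxx
    simp)).toAddMonoidHom +
  (AddMonoidHom.mulLeft β).comp (AdjoinRoot.lift (RingHom.id _) 1 (by
    obtain ⟨g, rfl⟩ := hxx
    simp [CharTwo.add_self_eq_zero])).toAddMonoidHom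

theorem evalHom_mk {f : (ZMod 2)[X]} (hxx : X * (X + 1) ∣ f) (α β : ZMod 2) (p : (ZMod 2)[X]) :
    evalHom hxx α β (AdjoinRoot.mk f p) = α * p.eval 0 + β * p.eval 1 := by
  simp [evalHom, coeff_zero_eq_eval_zero]

theorem evalHom_mk_gcd {f : (ZMod 2)[X]} (hxx : X * (X + 1) ∣ f) (α β : ZMod 2)
    (p : (ZMod 2)[X]) :
    evalHom hxx α β (AdjoinRoot.mk f p) =
      α * (zmodTwoEvals (gcd p f)).1 + β * (zmodTwoEvals (gcd p f)).2 := by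
  rw [evalHom_mk, zmodTwoEvals_gcd p f hxx, zmodTwoEvals]

/-- Over `𝔽_2`, with `x(x+1) ∣ f` and `G_f(D)` connected:
`G_f(D)` is bipartite iff `|D̄| = 2`, where `D̄ = {gcd(f_i, x(x+1)) : f_i ∈ D}`. -/
theorem gcdGraph_bipartite_iff_card_eq_two
    (f : Polynomial (ZMod 2)) (hf : f.Monic) (hdeg : 0 < f.natDegree)
    (hxx : X * (X + 1) ∣ f)
    (D : Finset (Polynomial (ZMod 2))) (hD : ∀ d ∈ D, d.Monic ∧ d ∣ f ∧ d ≠ f)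
    (hconn : (gcdGraph f D).Connected) :
    (gcdGraph f D).Colorable 2 ↔ (D.image fun d => gcd d (X * (X + 1))).card = 2 := by
  have hfD : f ∉ D := fun h => (hD f h).2.2 rfl
  have hgcd : ∀ d ∈ D, gcd d f = d := fun d hd =>
    eq_of_dvd_of_dvd_zmod_two (gcd_dvd_left _ _) (dvd_gcd dvd_rfl (hD d hd).2.1)
  rw [card_image_gcd_eq_card_image_zmodTwoEvals, ← zmodTwo_finset_card_eq_two_iff]
  · simp only [Finset.forall_mem_image]
    constructor
    · intro hcol
      obtain ⟨χ, hχ⟩ := exists_hom_of_colorable hfD hconn hcol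
      refine ⟨χ (AdjoinRoot.mk f (X + 1)), χ (AdjoinRoot.mk f X), fun d hd => ?_⟩
      have hC : ∀ (a : ZMod 2) (p : (ZMod 2)[X]),
          χ (AdjoinRoot.mk f (C a * p)) = χ (AdjoinRoot.mk f p) * a := by
        intro a p
        obtain rfl | rfl : a = 0 ∨ a = 1 := by revert a; decide
        all_goals simp
      obtain ⟨r, hr⟩ := exists_eq_of_zmodTwoEvals d
      have h1 := hχ d (by rwa [hgcd d hd])
      rw [hr, map_add, map_add, map_add, map_add, hom_mul_eq_zero hf hconn χ hχ, hC, hC,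
        add_zero] at h1
      exact h1
    · rintro ⟨α, β, h⟩
      have key : ∀ p, gcd p f ∈ D → evalHom hxx α β (AdjoinRoot.mk f p) = 1 := fun p hp => by
        rw [evalHom_mk_gcd]
        exact h hp
      refine (SimpleGraph.Coloring.mk (evalHom hxx α β) ?_).colorable
      rintro u v ⟨-, ⟨p, hp, hpD⟩ | ⟨p, hp, hpD⟩⟩ huv
      all_goals
        have := key p hpD
        rw [hp, map_sub, huv, sub_self] at this
        exact zero_ne_one this
  · intro α β h
    simp only [Finset.forall_mem_image] at h
    have htop : (evalHom hxx α β).ker = ⊤ :=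
      eq_top_of_gcdGraph_connected hconn _ fun p hp => by
        rw [AddMonoidHom.mem_ker, evalHom_mk_gcd]
        exact h hp
    have hz : ∀ p : (ZMod 2)[X], α * p.eval 0 + β * p.eval 1 = 0 := fun p => by
      rw [← evalHom_mk hxx, ← AddMonoidHom.mem_ker, htop]
      exact AddSubgroup.mem_top _
    have hβ : β = 0 := by simpa using hz X
    refine ⟨?_, hβ⟩
    simpa [hβ] using hz 1
end

section
/- Let n ≥ 2 be an integer and let D = {d_1, …, d_k} be a set of proper positive divisors of n with gcd(d_1, d_2, …, d_k) = 1. Then the gcd-graph G_n(D) is bipartite if and only if n is even and every d_i is odd. -/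
/-- The gcd-graph `G_n(D)`: vertices are `ℤ/nℤ`, and two distinct vertices are adjacent
iff the gcd of an integer representative of their difference with `n` lies in `D`. -/
def gcdGraphZMod (n : ℕ) (D : Finset ℕ) : SimpleGraph (ZMod n) :=
  SimpleGraph.fromRel fun a b =>
    ∃ m : ℤ, (m : ZMod n) = a - b ∧ m.gcd (n : ℤ) ∈ D

theorem gcdGraphZMod_adj_of_sub_eq {n d : ℕ} {D : Finset ℕ} (hd : d ∈ D)
    (hdvd : d ∣ n) (hne : d ≠ n) {a b : ZMod n} (hab : a - b = d) :
    (gcdGraphZMod n D).Adj a b := by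
  rw [gcdGraphZMod, SimpleGraph.fromRel_adj]
  refine ⟨?_, Or.inl ⟨d, ?_, ?_⟩⟩
  · rintro rfl
    rw [sub_self, eq_comm, ZMod.natCast_eq_zero_iff] at hab
    exact hne (Nat.dvd_antisymm hdvd hab)
  · rw [hab, Int.cast_natCast]
  · rwa [Int.gcd_natCast_natCast, Nat.gcd_eq_left hdvd]

/-- Along the walk `0, d, 2d, …` with `d ∈ D`, a 2-coloring of the gcd-graph alternates. -/
theorem gcdGraphZMod_coloring_mul_eq_iff {n d : ℕ} {D : Finset ℕ}
    (c : (gcdGraphZMod n D).Coloring (Fin 2)) (hd : d ∈ D)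
    (hdvd : d ∣ n) (hne : d ≠ n) (k : ℕ) :
    c ((k * d : ℕ) : ZMod n) = c 0 ↔ Even k := by
  induction k with
  | zero => simp
  | succ k ih =>
    have hflip : c (((k + 1) * d : ℕ) : ZMod n) ≠ c ((k * d : ℕ) : ZMod n) :=
      c.valid (gcdGraphZMod_adj_of_sub_eq hd hdvd hne (by push_cast; ring))
    rw [Nat.even_add_one, ← ih]
    omega

theorem gcdGraphZMod_colorable_two_of_odd {n : ℕ} {D : Finset ℕ} (hn : Even n)
    (hD : ∀ d ∈ D, Odd d) : (gcdGraphZMod n D).Colorable 2 := by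
  have hodd : ∀ a b : ZMod n, (∃ m : ℤ, (m : ZMod n) = a - b ∧ m.gcd (n : ℤ) ∈ D) →
      ZMod.castHom hn.two_dvd (ZMod 2) a ≠ ZMod.castHom hn.two_dvd (ZMod 2) b := by
    rintro a b ⟨m, hm, hmD⟩ hab
    have hm2 : (m : ZMod 2) = 0 := by
      rw [← map_intCast (ZMod.castHom hn.two_dvd (ZMod 2)), hm, map_sub, hab, sub_self]
    have hdvd : 2 ∣ m.gcd n :=
      Int.dvd_gcd ((ZMod.intCast_zmod_eq_zero_iff_dvd m 2).1 hm2)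
        (Int.natCast_dvd_natCast.2 hn.two_dvd)
    exact Nat.not_even_iff_odd.2 (hD _ hmD) (even_iff_two_dvd.2 hdvd)
  refine ⟨SimpleGraph.Coloring.mk (ZMod.castHom hn.two_dvd (ZMod 2)) ?_⟩
  intro a b hab
  rw [gcdGraphZMod, SimpleGraph.fromRel_adj] at hab
  exact hab.2.elim (hodd a b) fun h => (hodd b a h).symm

/-- For `n ≥ 2` and a set `D` of proper positive divisors of `n` with `gcd(D) = 1`,
the gcd-graph `G_n(D)` is bipartite iff `n` is even and every element of `D` is odd. -/
theorem gcdGraphZMod_bipartite_iff (n : ℕ) (hn : 2 ≤ n)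
    (D : Finset ℕ) (hD : ∀ d ∈ D, 0 < d ∧ d ∣ n ∧ d ≠ n)
    (hgcd : D.gcd id = 1) :
    (gcdGraphZMod n D).Colorable 2 ↔ Even n ∧ ∀ d ∈ D, Odd d := by
  refine ⟨?_, fun h => gcdGraphZMod_colorable_two_of_odd h.1 h.2⟩
  rintro ⟨c⟩
  have key : ∀ d ∈ D, ∀ k : ℕ, c ((k * d : ℕ) : ZMod n) = c 0 ↔ Even k := fun d hd =>
    gcdGraphZMod_coloring_mul_eq_iff c hd (hD d hd).2.1 (hD d hd).2.2
  obtain ⟨e, he, heodd⟩ : ∃ e ∈ D, Odd e := by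
    by_contra! h
    have h2 : 2 ∣ D.gcd id :=
      Finset.dvd_gcd fun d hd => (Nat.not_odd_iff_even.1 (h d hd)).two_dvd
    omega
  constructor
  · obtain ⟨k, rfl⟩ := (hD e he).2.1
    have hk : Even k := (key e he k).1 (by rw [mul_comm k e, ZMod.natCast_self])
    exact hk.mul_left e
  · intro d hd
    by_contra hdodd
    have h := (key e he d).2 (Nat.not_odd_iff_even.1 hdodd)
    rw [mul_comm] at h
    exact Nat.not_even_iff_odd.2 heodd ((key d hd e).1 h)
end

section
/- Let f ∈ 𝔽_q[x] be a nonconstant monic polynomial, let a, b ∈ 𝔽_q[x], and let c be a monic divisor of f. Suppose gcd(a, b) = gcd(b, c) = m (gcds normalized to be monic). Then there exists t ∈ 𝔽_q[x] such that gcd(a − b·t, f) = c. -/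
open Polynomial

section PrincipalIdealRing

variable {R : Type*} [CommRing R] [IsDomain R] [IsPrincipalIdealRing R]

/-- A residue class coprime to its modulus `b` contains an element coprime to any given nonzero
`g`. -/
theorem IsCoprime.exists_isCoprime_sub_mul {k b g : R} (h : IsCoprime k b) (hg : g ≠ 0) :
    ∃ s, IsCoprime (k - b * s) g := by
  classical
  let S := (UniqueFactorizationMonoid.factors g).toFinset.filter fun q ↦ ¬ q ∣ k
  refine ⟨∏ q ∈ S, q, isCoprime_of_prime_dvd (fun h0 ↦ hg h0.2) fun p hp hpk hpg ↦ ?_⟩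
  by_cases hk : p ∣ k
  · have hbs : p ∣ b * ∏ q ∈ S, q := (dvd_sub_right hk).1 hpk
    rcases hp.dvd_or_dvd hbs with hb | hs
    · exact hp.not_isUnit (h.isUnit_of_dvd' hk hb)
    · obtain ⟨q, hq, hpq⟩ := hp.exists_mem_finset_dvd hs
      obtain ⟨hqg, hqk⟩ := Finset.mem_filter.1 hq
      have hq' : Irreducible q :=
        UniqueFactorizationMonoid.irreducible_of_factor q (Multiset.mem_toFinset.1 hqg)
      exact hqk ((hp.irreducible.associated_of_dvd hq' hpq).dvd_iff_dvd_left.1 hk)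
  · obtain ⟨q, hq, hpq⟩ :=
      UniqueFactorizationMonoid.exists_mem_factors_of_dvd hg hp.irreducible hpg
    have hqS : q ∈ S := Finset.mem_filter.2
      ⟨Multiset.mem_toFinset.2 hq, fun hqk ↦ hk (hpq.dvd.trans hqk)⟩
    have hps : p ∣ b * ∏ q ∈ S, q :=
      (hpq.dvd.trans (Finset.dvd_prod_of_mem (fun q ↦ q) hqS)).mul_left b
    exact hk ((dvd_sub_left hps).1 hpk)

/-- If `b` is coprime to both `a` and `c`, then some element of the residue class of `a` modulo `b`
is `c` times an element coprime to any given nonzero `g`. -/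
theorem IsCoprime.exists_sub_mul_eq_mul {a b c g : R} (hab : IsCoprime a b) (hbc : IsCoprime b c)
    (hg : g ≠ 0) : ∃ t u, a - b * t = c * u ∧ IsCoprime u g := by
  obtain ⟨x, y, hxy⟩ := hbc
  have hk : IsCoprime (a * y) b :=
    hab.mul_left ⟨c, x, by linear_combination hxy⟩
  obtain ⟨s, hs⟩ := hk.exists_isCoprime_sub_mul hg
  exact ⟨a * x + c * s, a * y - b * s, by linear_combination -a * hxy, hs⟩

end PrincipalIdealRing

variable {Fq : Type} [Field Fq] [Fintype Fq] [DecidableEq Fq]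

/-- If `c` is a monic divisor of `f` and `gcd(a, b) = gcd(b, c) = m`, then there exists
`t` with `gcd(a − b·t, f) = c` (all gcds normalized to be monic). -/
theorem exists_gcd_sub_mul_eq
    (f : Polynomial Fq) (hf : f.Monic) (hdeg : 0 < f.natDegree)
    (a b c m : Polynomial Fq) (hc : c.Monic) (hcf : c ∣ f)
    (hab : gcd a b = m) (hbc : gcd b c = m) :
    ∃ t : Polynomial Fq, gcd (a - b * t) f = c := by
  obtain ⟨g, rfl⟩ := hcf
  have hg : g ≠ 0 := right_ne_zero_of_mul hf.ne_zero
  obtain ⟨a', b', ha, hb, hab'⟩ := extract_gcd a b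
  obtain ⟨b'', c', hb', hc', hbc'⟩ := extract_gcd b c
  rw [hab] at ha hb
  rw [hbc] at hb' hc'
  have hm : m ≠ 0 := left_ne_zero_of_mul (hc' ▸ hc.ne_zero)
  obtain rfl : b' = b'' := mul_left_cancel₀ hm (hb.symm.trans hb')
  obtain ⟨t, u, htu, hu⟩ := IsCoprime.exists_sub_mul_eq_mul
    ((gcd_isUnit_iff _ _).1 hab') ((gcd_isUnit_iff _ _).1 hbc') hg
  have hcu : a - b * t = c * u := by
    rw [ha, hb, hc']
    linear_combination m * htu
  have hug : gcd u g = 1 := by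
    rw [← normalize_gcd, normalize_eq_one]
    exact (gcd_isUnit_iff _ _).2 hu
  exact ⟨t, by rw [hcu, gcd_mul_left, hug, mul_one, hc.normalize_eq_self]⟩
end

section
/- Let f ∈ 𝔽_q[x] be a nonconstant monic polynomial, D = {f_1, …, f_k} a set of monic proper divisors of f, and let g be a monic proper divisor of f. Let I_g be the ideal of R = 𝔽_q[x]/(f) generated by g, and let D_g = {f_i/g : f_i ∈ D and g divides f_i}, a set of monic proper divisors of f/g. Then the induced subgraph of the gcd-graph G_f(D) on the vertex set I_g is isomorphic to the gcd-graph G_{f/g}(D_g). -/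
open Polynomial

variable {Fq : Type} [Field Fq] [Fintype Fq] [DecidableEq Fq]

theorem gcd_mul_left_of_monic {K : Type*} [Field K] [DecidableEq K] {g : Polynomial K}
    (hg : g.Monic) (p m : Polynomial K) :
    gcd (g * p) (g * m) = g * gcd p m := by
  rw [gcd_mul_left, hg.normalize_eq_self]

/-- Multiplication by `g`, as a map from `K[x]/(m)` to `K[x]/(g m)`. -/
noncomputable def AdjoinRoot.mulLeft {K : Type*} [Field K] (g m : Polynomial K)
    (u : AdjoinRoot m) : AdjoinRoot (g * m) :=
  AdjoinRoot.mk (g * m) (g * Function.surjInv AdjoinRoot.mk_surjective u)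

theorem AdjoinRoot.mk_mul_left_eq_mk {K : Type*} [Field K] {g : Polynomial K} (hg : g ≠ 0)
    {m p q : Polynomial K} :
    AdjoinRoot.mk (g * m) (g * p) = AdjoinRoot.mk (g * m) (g * q) ↔
      AdjoinRoot.mk m p = AdjoinRoot.mk m q := by
  rw [AdjoinRoot.mk_eq_mk, AdjoinRoot.mk_eq_mk, ← mul_sub, mul_dvd_mul_iff_left hg]

theorem AdjoinRoot.mulLeft_mk {K : Type*} [Field K] {g : Polynomial K} (hg : g ≠ 0)
    (m p : Polynomial K) :
    AdjoinRoot.mulLeft g m (AdjoinRoot.mk m p) = AdjoinRoot.mk (g * m) (g * p) :=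
  (AdjoinRoot.mk_mul_left_eq_mk hg).2 (Function.surjInv_eq AdjoinRoot.mk_surjective _)

theorem AdjoinRoot.mulLeft_injective {K : Type*} [Field K] {g : Polynomial K} (hg : g ≠ 0)
    (m : Polynomial K) :
    Function.Injective (AdjoinRoot.mulLeft g m) := by
  intro u v h
  obtain ⟨p, rfl⟩ := AdjoinRoot.mk_surjective u
  obtain ⟨q, rfl⟩ := AdjoinRoot.mk_surjective v
  rwa [AdjoinRoot.mulLeft_mk hg, AdjoinRoot.mulLeft_mk hg,
    AdjoinRoot.mk_mul_left_eq_mk hg] at h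

theorem AdjoinRoot.range_mulLeft {K : Type*} [Field K] {g : Polynomial K} (hg : g ≠ 0)
    (m : Polynomial K) :
    Set.range (AdjoinRoot.mulLeft g m) =
      (Ideal.span {AdjoinRoot.mk (g * m) g} : Ideal (AdjoinRoot (g * m))) := by
  ext x
  rw [SetLike.mem_coe, Ideal.mem_span_singleton']
  constructor
  · rintro ⟨u, rfl⟩
    obtain ⟨p, rfl⟩ := AdjoinRoot.mk_surjective u
    exact ⟨AdjoinRoot.mk _ p, by rw [AdjoinRoot.mulLeft_mk hg, ← map_mul, mul_comm p g]⟩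
  · rintro ⟨a, rfl⟩
    obtain ⟨p, rfl⟩ := AdjoinRoot.mk_surjective a
    exact ⟨AdjoinRoot.mk m p, by rw [AdjoinRoot.mulLeft_mk hg, ← map_mul, mul_comm p g]⟩

theorem exists_gcd_mem_mulLeft_iff {K : Type*} [Field K] [DecidableEq K] {g : Polynomial K}
    (hg : g.Monic) (m : Polynomial K) {D E : Finset (Polynomial K)}
    (hE : ∀ d, d ∈ E ↔ g * d ∈ D) (u v : AdjoinRoot m) :
    (∃ p, AdjoinRoot.mk (g * m) p = AdjoinRoot.mulLeft g m u - AdjoinRoot.mulLeft g m v ∧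
        gcd p (g * m) ∈ D) ↔
      ∃ p, AdjoinRoot.mk m p = u - v ∧ gcd p m ∈ E := by
  obtain ⟨a, rfl⟩ := AdjoinRoot.mk_surjective u
  obtain ⟨b, rfl⟩ := AdjoinRoot.mk_surjective v
  simp only [AdjoinRoot.mulLeft_mk hg.ne_zero, ← map_sub, ← mul_sub]
  constructor
  · rintro ⟨p, hp, hD⟩
    obtain ⟨p, rfl⟩ : g ∣ p :=
      (dvd_iff_dvd_of_dvd_sub ((dvd_mul_right g m).trans (AdjoinRoot.mk_eq_mk.1 hp))).2
        (dvd_mul_right _ _)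
    rw [gcd_mul_left_of_monic hg] at hD
    exact ⟨p, (AdjoinRoot.mk_mul_left_eq_mk hg.ne_zero).1 hp, (hE _).2 hD⟩
  · rintro ⟨p, hp, h⟩
    refine ⟨g * p, (AdjoinRoot.mk_mul_left_eq_mk hg.ne_zero).2 hp, ?_⟩
    rw [gcd_mul_left_of_monic hg]
    exact (hE _).1 h

theorem gcdGraph_adj_mulLeft_iff {K : Type} [Field K] [DecidableEq K] {g : Polynomial K}
    (hg : g.Monic) (m : Polynomial K) {D E : Finset (Polynomial K)}
    (hE : ∀ d, d ∈ E ↔ g * d ∈ D) (u v : AdjoinRoot m) :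
    (gcdGraph (g * m) D).Adj (AdjoinRoot.mulLeft g m u) (AdjoinRoot.mulLeft g m v) ↔
      (gcdGraph m E).Adj u v := by
  simp only [gcdGraph, SimpleGraph.fromRel_adj, exists_gcd_mem_mulLeft_iff hg m hE,
    (AdjoinRoot.mulLeft_injective hg.ne_zero m).ne_iff]

/-- For a monic proper divisor `g` of `f`, the induced subgraph of `G_f(D)` on the ideal
`I_g = (g)` of `𝔽_q[x]/(f)` is isomorphic to the gcd-graph `G_{f/g}(D_g)`, where
`D_g = {f_i/g : f_i ∈ D, g ∣ f_i}`. -/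
theorem induce_ideal_iso_gcdGraph
    (f : Polynomial Fq) (hf : f.Monic) (hdeg : 0 < f.natDegree)
    (D : Finset (Polynomial Fq)) (hD : ∀ d ∈ D, d.Monic ∧ d ∣ f ∧ d ≠ f)
    (g : Polynomial Fq) (hg : g.Monic) (hgf : g ∣ f) (hgne : g ≠ f) :
    letI : DecidablePred fun d : Polynomial Fq => g ∣ d := Classical.decPred _
    Nonempty
      (((gcdGraph f D).induce
          ((Ideal.span {AdjoinRoot.mk f g} : Ideal (AdjoinRoot f)) : Set (AdjoinRoot f))) ≃g
        gcdGraph (f / g) ((D.filter fun d => g ∣ d).image fun d => d / g)) := by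
  classical
  obtain ⟨m, rfl⟩ := hgf
  have hg0 := hg.ne_zero
  rw [mul_div_cancel_left₀ m hg0]
  refine ⟨RelIso.symm ⟨(Equiv.ofInjective _ (AdjoinRoot.mulLeft_injective hg0 m)).trans
    (Equiv.setCongr (AdjoinRoot.range_mulLeft hg0 m)), ?_⟩⟩
  intro u v
  refine gcdGraph_adj_mulLeft_iff hg m (fun d => ?_) u v
  simp only [Finset.mem_image, Finset.mem_filter]
  constructor
  · rintro ⟨_, ⟨h, c, rfl⟩, rfl⟩
    rwa [mul_div_cancel_left₀ c hg0]
  · intro h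
    exact ⟨g * d, ⟨h, dvd_mul_right _ _⟩, mul_div_cancel_left₀ d hg0⟩
end

section
/- Let f ∈ 𝔽_q[x] be a nonconstant monic polynomial, D = {f_1, …, f_k} a set of monic proper divisors of f, g a monic divisor of f, and I the ideal of 𝔽_q[x]/(f) generated by g. Set D_1 = {f_i ∈ D : g does not divide f_i} and D̄_1 = {gcd(f_i, g) : f_i ∈ D_1}. Then the underlying set of I is a homogeneous set in the gcd-graph G_f(D) if and only if {h : h a monic divisor of f with gcd(h, g) ∈ D̄_1} = D_1. -/
open Polynomial

/-- A set `X` of vertices is homogeneous if every vertex outside of `X` is adjacent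
either to all vertices of `X` or to none of them. -/
def IsHomogeneousSet {V : Type} (G : SimpleGraph V) (X : Set V) : Prop :=
  ∀ v ∉ X, (∀ x ∈ X, G.Adj v x) ∨ (∀ x ∈ X, ¬ G.Adj v x)

variable {Fq : Type} [Field Fq] [Fintype Fq] [DecidableEq Fq]

/-- A residue coprime to the modulus `b` can be lifted to an element coprime to any given
nonzero element. -/
theorem exists_isCoprime_add_mul {R : Type*} [CommRing R] [IsDomain R] [IsPrincipalIdealRing R]
    {a b n : R} (hab : IsCoprime a b) (hn : n ≠ 0) : ∃ t, IsCoprime (a + b * t) n := by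
  induction n using UniqueFactorizationMonoid.induction_on_prime with
  | h₁ => exact absurd rfl hn
  | h₂ u hu => exact ⟨0, isCoprime_one_right.of_isCoprime_of_dvd_right (isUnit_iff_dvd_one.1 hu)⟩
  | h₃ m p hm hp ih =>
    obtain ⟨t, ht⟩ := ih hm
    by_cases hpt : p ∣ a + b * t
    · refine ⟨t + m, IsCoprime.mul_right ?_ ?_⟩
      · rw [isCoprime_comm, hp.coprime_iff_not_dvd]
        intro h
        have hbm : p ∣ b * m := by
          have := dvd_sub h hpt
          rwa [show a + b * (t + m) - (a + b * t) = b * m by ring] at this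
        rcases hp.dvd_or_dvd hbm with hb | hm'
        · have ha : p ∣ a := (dvd_add_left (hb.mul_right t)).1 hpt
          exact hp.not_isUnit (hab.isUnit_of_dvd' ha hb)
        · exact hp.not_isUnit (ht.isUnit_of_dvd' hpt hm')
      · rw [show a + b * (t + m) = a + b * t + b * m by ring]
        exact ht.add_mul_right_left b
    · exact ⟨t, IsCoprime.mul_right ((hp.coprime_iff_not_dvd.2 hpt).symm) ht⟩

/-- Two elements with the same gcd with `g` agree modulo `g` up to a factor coprime to `n`. -/
theorem exists_isCoprime_dvd_sub_mul {R : Type*} [CommRing R] [IsDomain R]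
    [IsPrincipalIdealRing R] [GCDMonoid R] {h d g n : R} (hg : g ≠ 0) (hn : n ≠ 0)
    (hgcd : gcd h g = gcd d g) : ∃ u, IsCoprime u n ∧ g ∣ h - d * u := by
  obtain ⟨h', g', hh, hg', hhg⟩ := extract_gcd h g
  obtain ⟨d', k, hd, hk, hdk⟩ := extract_gcd d g
  rw [hgcd] at hh hg'
  have he : gcd d g ≠ 0 := gcd_ne_zero_of_right hg
  obtain rfl : g' = k := mul_left_cancel₀ he (hg'.symm.trans hk)
  rw [gcd_isUnit_iff] at hhg hdk
  obtain ⟨x, y, hxy⟩ := hdk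
  have hx : IsCoprime x g' := ⟨d', y, by rw [mul_comm d', hxy]⟩
  obtain ⟨t, ht⟩ := exists_isCoprime_add_mul (hhg.mul_left hx) hn
  refine ⟨h' * x + g' * t, ht, y * h' - d' * t, ?_⟩
  generalize gcd d g = e at *
  rw [hh, hd, hg']
  linear_combination (-e * h') * hxy

theorem monic_gcd_right {F : Type} [Field F] [DecidableEq F] (p : F[X]) {f : F[X]}
    (hf : f ≠ 0) : (gcd p f).Monic := by
  have h0 : gcd p f ≠ 0 := gcd_ne_zero_of_right hf
  rw [← normalize_gcd p f]
  exact Polynomial.monic_normalize h0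

theorem gcd_eq_self_of_monic_of_dvd {F : Type} [Field F] [DecidableEq F] {h f : F[X]}
    (hh : h.Monic) (hf : f ≠ 0) (hdvd : h ∣ f) :
    gcd h f = h :=
  eq_of_monic_of_associated (monic_gcd_right h hf) hh
    (associated_of_dvd_dvd (gcd_dvd_left h f) (dvd_gcd dvd_rfl hdvd))

theorem gcdGraph_adj_mk {F : Type} [Field F] [DecidableEq F]
    {f : F[X]} {D : Finset F[X]} (hfD : f ∉ D) (hf : f.Monic) (p q : F[X]) :
    (gcdGraph f D).Adj (AdjoinRoot.mk f p) (AdjoinRoot.mk f q) ↔ gcd (p - q) f ∈ D := by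
  have key : ∀ p q r : F[X], AdjoinRoot.mk f r = AdjoinRoot.mk f p - AdjoinRoot.mk f q →
      gcd r f = gcd (p - q) f := by
    intro p q r h
    rw [← map_sub, AdjoinRoot.mk_eq_mk] at h
    exact gcd_eq_of_dvd_sub_left h
  have hneg : gcd (q - p) f = gcd (p - q) f := by
    rw [← neg_sub]
    exact eq_of_monic_of_associated (monic_gcd_right _ hf.ne_zero) (monic_gcd_right _ hf.ne_zero)
      (Associated.gcd (Associated.neg_left (Associated.refl _)) (Associated.refl _))
  simp only [gcdGraph, SimpleGraph.fromRel_adj]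
  constructor
  · rintro ⟨-, ⟨r, hr, hD⟩ | ⟨r, hr, hD⟩⟩
    · rwa [← key p q r hr]
    · rwa [← hneg, ← key q p r hr]
  · intro h
    refine ⟨fun heq => hfD ?_, Or.inl ⟨p - q, map_sub _ _ _, h⟩⟩
    rw [AdjoinRoot.mk_eq_mk] at heq
    rwa [eq_of_monic_of_associated (monic_gcd_right _ hf.ne_zero) hf
      (associated_of_dvd_dvd (gcd_dvd_right _ _) (dvd_gcd heq dvd_rfl))] at h

theorem mk_mem_span_singleton_iff {F : Type} [Field F] {f g : F[X]} (hgf : g ∣ f) (p : F[X]) :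
    AdjoinRoot.mk f p ∈ Ideal.span {AdjoinRoot.mk f g} ↔ g ∣ p := by
  rw [Ideal.mem_span_singleton']
  constructor
  · rintro ⟨a, ha⟩
    obtain ⟨a, rfl⟩ := AdjoinRoot.mk_surjective a
    rw [← map_mul, AdjoinRoot.mk_eq_mk] at ha
    exact (dvd_sub_right (dvd_mul_left g a)).1 (hgf.trans ha)
  · rintro ⟨a, rfl⟩
    exact ⟨AdjoinRoot.mk f a, by rw [← map_mul, mul_comm]⟩

/-- For a monic divisor `g` of `f`, the ideal `I = (g)` of `𝔽_q[x]/(f)` is a homogeneous set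
in `G_f(D)` iff `{h monic divisor of f : gcd(h, g) ∈ D̄₁} = D₁`, where `D₁` is the set of
elements of `D` not divisible by `g` and `D̄₁ = {gcd(f_i, g) : f_i ∈ D₁}`. -/
theorem ideal_homogeneous_iff
    (f : Polynomial Fq) (hf : f.Monic) (hdeg : 0 < f.natDegree)
    (D : Finset (Polynomial Fq)) (hD : ∀ d ∈ D, d.Monic ∧ d ∣ f ∧ d ≠ f)
    (g : Polynomial Fq) (hg : g.Monic) (hgf : g ∣ f) :
    letI : DecidablePred fun d : Polynomial Fq => ¬ g ∣ d := Classical.decPred _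
    (IsHomogeneousSet (gcdGraph f D)
        ((Ideal.span {AdjoinRoot.mk f g} : Ideal (AdjoinRoot f)) : Set (AdjoinRoot f)) ↔
      {h : Polynomial Fq | h.Monic ∧ h ∣ f ∧
          gcd h g ∈ (D.filter fun d => ¬ g ∣ d).image fun d => gcd d g} =
        ((D.filter fun d => ¬ g ∣ d) : Set (Polynomial Fq))) := by
  classical
  have hf0 := hf.ne_zero
  have hfD : f ∉ D := fun h => (hD f h).2.2 rfl
  have hgD : ∀ {p d : Fq[X]}, ¬ g ∣ p → gcd p g = gcd d g → ¬ g ∣ d := fun hp h hd =>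
    hp <| (dvd_gcd hd dvd_rfl).trans (h ▸ gcd_dvd_left _ _)
  constructor
  · intro hom
    ext h
    simp only [Set.mem_ofPred_eq, Finset.mem_image, Finset.mem_filter, Finset.mem_coe]
    constructor
    · rintro ⟨hh, hhf, d, ⟨hdD, hgd⟩, hgcd⟩
      have hgh : ¬ g ∣ h := hgD hgd hgcd
      obtain ⟨u, hu, s, hs⟩ := exists_isCoprime_dvd_sub_mul hg.ne_zero hf0 hgcd.symm
      have hadj : (gcdGraph f D).Adj (AdjoinRoot.mk f h) (AdjoinRoot.mk f (g * s)) := by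
        rw [gcdGraph_adj_mk hfD hf, ← hs, sub_sub_cancel]
        obtain ⟨hdm, hdf, -⟩ := hD d hdD
        suffices gcd (d * u) f = d by rwa [this]
        refine eq_of_monic_of_associated (monic_gcd_right _ hf0) hdm
          (associated_of_dvd_dvd ?_ (dvd_gcd (dvd_mul_right d u) hdf))
        exact (hu.symm.of_isCoprime_of_dvd_left (gcd_dvd_right _ _)).dvd_of_dvd_mul_right
          (gcd_dvd_left _ _)
      rcases hom (AdjoinRoot.mk f h) (mt (mk_mem_span_singleton_iff hgf h).1 hgh) with H | H
      · have := H (AdjoinRoot.mk f 0) ((mk_mem_span_singleton_iff hgf 0).2 (dvd_zero g))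
        rw [gcdGraph_adj_mk hfD hf, sub_zero, gcd_eq_self_of_monic_of_dvd hh hf0 hhf] at this
        exact ⟨this, hgh⟩
      · exact absurd hadj (H _ ((mk_mem_span_singleton_iff hgf _).2 (dvd_mul_right g s)))
    · rintro ⟨hhD, hgh⟩
      exact ⟨(hD h hhD).1, (hD h hhD).2.1, h, ⟨hhD, hgh⟩, rfl⟩
  · intro heq v hv
    obtain ⟨p, rfl⟩ := AdjoinRoot.mk_surjective v
    have hgp : ¬ g ∣ p := mt (mk_mem_span_singleton_iff hgf p).2 hv
    have hadj : ∀ q : Fq[X], g ∣ q →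
        ((gcdGraph f D).Adj (AdjoinRoot.mk f p) (AdjoinRoot.mk f q) ↔
          ∃ d, (d ∈ D ∧ ¬ g ∣ d) ∧ gcd d g = gcd p g) := by
      intro q hq
      have hgcd : gcd (gcd (p - q) f) g = gcd p g := by
        rw [gcd_assoc, (associated_gcd_right_iff.2 hgf).symm.gcd_eq_right]
        exact gcd_eq_of_dvd_sub_left (by simpa using hq)
      have hmem := Set.ext_iff.1 heq (gcd (p - q) f)
      simp only [Set.mem_ofPred_eq, hgcd, Finset.mem_coe, Finset.mem_image,
        Finset.mem_filter] at hmem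
      rw [gcdGraph_adj_mk hfD hf]
      constructor
      · exact fun h => (hmem.2 ⟨h, hgD hgp hgcd.symm⟩).2.2
      · exact fun h => (hmem.1 ⟨monic_gcd_right _ hf0, gcd_dvd_right _ _, h⟩).1
    by_cases h : ∃ d, (d ∈ D ∧ ¬ g ∣ d) ∧ gcd d g = gcd p g
    · refine Or.inl fun x hx => ?_
      obtain ⟨q, rfl⟩ := AdjoinRoot.mk_surjective x
      exact (hadj q ((mk_mem_span_singleton_iff hgf q).1 hx)).2 h
    · refine Or.inr fun x hx => ?_
      obtain ⟨q, rfl⟩ := AdjoinRoot.mk_surjective x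
      exact mt (hadj q ((mk_mem_span_singleton_iff hgf q).1 hx)).1 h
end

section
/- Let f ∈ 𝔽_q[x] be a squarefree nonconstant monic polynomial such that the unitary Cayley graph G_f({1}) is connected. Let D = {f_1, …, f_k} be a set of monic proper divisors of f such that f_i does not divide f_j for all i ≠ j, and such that the gcd-graph G_f(D) is connected and its complement graph is also connected. Then G_f(D) is a prime graph. -/
open Polynomial

/-- A graph is prime if it has no nontrivial homogeneous set, i.e. no homogeneous set `X`
with `2 ≤ |X| < |V(G)|`. -/
def IsPrimeGraph {V : Type} (G : SimpleGraph V) : Prop :=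
  ¬ ∃ X : Set V, 2 ≤ X.ncard ∧ X.ncard < Nat.card V ∧ IsHomogeneousSet G X

variable {Fq : Type} [Field Fq] [Fintype Fq] [DecidableEq Fq]

section HomogeneousSets

variable {V : Type} {G : SimpleGraph V} {X Y : Set V}

theorem IsHomogeneousSet.adj_iff (hX : IsHomogeneousSet G X) {v x y : V} (hv : v ∉ X)
    (hx : x ∈ X) (hy : y ∈ X) : G.Adj v x ↔ G.Adj v y := by
  rcases hX v hv with h | h
  · exact iff_of_true (h x hx) (h y hy)
  · exact iff_of_false (h x hx) (h y hy)

theorem isHomogeneousSet_of_adj_iff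
    (h : ∀ v ∉ X, ∀ x ∈ X, ∀ y ∈ X, G.Adj v x → G.Adj v y) : IsHomogeneousSet G X := by
  intro v hv
  by_cases hx : ∃ x ∈ X, G.Adj v x
  · obtain ⟨x, hx, hvx⟩ := hx
    exact Or.inl fun y hy => h v hv x hx y hy hvx
  · exact Or.inr fun y hy hvy => hx ⟨y, hy, hvy⟩

theorem IsHomogeneousSet.preimage (hX : IsHomogeneousSet G X) {e : V → V}
    (he : ∀ u v, G.Adj (e u) (e v) ↔ G.Adj u v) : IsHomogeneousSet G (e ⁻¹' X) := by
  intro v hv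
  refine (hX (e v) hv).imp (fun h x hx => ?_) (fun h x hx => ?_)
  · exact (he v x).1 (h _ hx)
  · exact fun hvx => h _ hx ((he v x).2 hvx)

theorem IsHomogeneousSet.union (hX : IsHomogeneousSet G X) (hY : IsHomogeneousSet G Y)
    (hXY : (X ∩ Y).Nonempty) : IsHomogeneousSet G (X ∪ Y) := by
  obtain ⟨z, hzX, hzY⟩ := hXY
  have key : ∀ v ∉ X ∪ Y, ∀ x ∈ X ∪ Y, (G.Adj v x ↔ G.Adj v z) := by
    intro v hv x hx
    rw [Set.mem_union, not_or] at hv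
    rcases hx with hx | hx
    · exact hX.adj_iff hv.1 hx hzX
    · exact hY.adj_iff hv.2 hx hzY
  exact isHomogeneousSet_of_adj_iff fun v hv x hx y hy h =>
    (key v hv y hy).2 ((key v hv x hx).1 h)

theorem SimpleGraph.Connected.exists_adj_mem_notMem (hG : G.Connected) (hX : X.Nonempty)
    (hX' : X ≠ Set.univ) : ∃ x ∈ X, ∃ y ∉ X, G.Adj y x := by
  obtain ⟨a, ha⟩ := hX
  obtain ⟨b, hb⟩ := (Set.ne_univ_iff_exists_notMem X).1 hX'
  obtain ⟨p⟩ := hG.preconnected a b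
  obtain ⟨d, -, h₁, h₂⟩ := p.exists_boundary_dart X ha hb
  exact ⟨_, h₁, _, h₂, d.adj.symm⟩

theorem IsHomogeneousSet.union_ne_univ (hX : IsHomogeneousSet G X) (hY : IsHomogeneousSet G Y)
    (hXY : (X ∩ Y).Nonempty) (hX' : X ≠ Set.univ) (hY' : Y ≠ Set.univ)
    (hG : G.Connected) (hGc : Gᶜ.Connected) : X ∪ Y ≠ Set.univ := by
  intro hU
  obtain ⟨z, hzX, -⟩ := hXY
  obtain ⟨w, hw⟩ := (Set.ne_univ_iff_exists_notMem Y).1 hY'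
  have cover : ∀ v, v ∈ X ∨ v ∈ Y := fun v => by
    rw [← Set.mem_union, hU]; trivial
  have hwX : w ∈ X := (cover w).resolve_right hw
  have same : ∀ x ∈ X, ∀ y ∉ X, ∀ x' ∈ X, ∀ y' ∉ X, G.Adj y x → G.Adj y' x' := by
    intro x hx y hy x' hx' y' hy' h
    have h₁ : G.Adj w y := ((hX.adj_iff hy hx hwX).1 h).symm
    have h₂ : G.Adj w y' :=
      (hY.adj_iff hw ((cover y).resolve_left hy) ((cover y').resolve_left hy')).1 h₁
    exact (hX.adj_iff hy' hwX hx').1 h₂.symm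
  obtain ⟨x, hx, y, hy, h⟩ := hG.exists_adj_mem_notMem ⟨z, hzX⟩ hX'
  obtain ⟨x', hx', y', hy', h'⟩ := hGc.exists_adj_mem_notMem ⟨z, hzX⟩ hX'
  have hadj := same x hx y hy x' hx' y' hy' h
  exact ((SimpleGraph.compl_adj _ _ _).1 h').2 hadj

/-- A proper homogeneous set of a finite graph that is connected and co-connected is contained
in a proper homogeneous set which absorbs every proper homogeneous set meeting it. -/
theorem IsHomogeneousSet.exists_absorbing [Finite V] (hX : IsHomogeneousSet G X)
    (hX' : X ≠ Set.univ) (hG : G.Connected) (hGc : Gᶜ.Connected) :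
    ∃ M, X ⊆ M ∧ M ≠ Set.univ ∧ IsHomogeneousSet G M ∧
      ∀ Y, IsHomogeneousSet G Y → Y ≠ Set.univ → (M ∩ Y).Nonempty → Y ⊆ M := by
  obtain ⟨M, hXM, hM⟩ := Finite.exists_le_maximal
    (p := fun Y : Set V => Y ≠ Set.univ ∧ IsHomogeneousSet G Y) ⟨hX', hX⟩
  refine ⟨M, hXM, hM.prop.1, hM.prop.2, fun Y hY hY' hMY => ?_⟩
  exact Set.subset_union_right.trans <| hM.le_of_ge
    ⟨hM.prop.2.union_ne_univ hY hMY hM.prop.1 hY' hG hGc, hM.prop.2.union hY hMY⟩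
    Set.subset_union_left

/-- In a finite connected and co-connected graph on a commutative ring which is invariant under
the maps `a ↦ w * a + c` with `w` a unit, a proper homogeneous set with at least two elements
gives rise to a nontrivial homogeneous ideal, as soon as the units generate the ring. -/
theorem IsHomogeneousSet.exists_ideal {R : Type} [CommRing R] [Finite R] {G : SimpleGraph R}
    (hadj : ∀ (w : Rˣ) (c u v : R), G.Adj (w * u + c) (w * v + c) ↔ G.Adj u v)
    (hunits : AddSubgroup.closure {r : R | IsUnit r} = ⊤)
    (hG : G.Connected) (hGc : Gᶜ.Connected) {X : Set R} (hX : IsHomogeneousSet G X)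
    (hX' : X ≠ Set.univ) (hX₂ : X.Nontrivial) :
    ∃ I : Ideal R, I ≠ ⊥ ∧ I ≠ ⊤ ∧ IsHomogeneousSet G (I : Set R) := by
  obtain ⟨x₀, hx₀, x₁, hx₁, hne⟩ := hX₂
  have hpre : ∀ (w : Rˣ) (c : R) (Y : Set R), IsHomogeneousSet G Y → Y ≠ Set.univ →
      IsHomogeneousSet G ((fun a => w * a + c) ⁻¹' Y) ∧
        (fun a => w * a + c) ⁻¹' Y ≠ Set.univ := by
    intro w c Y hY hY'
    refine ⟨hY.preimage (hadj w c), ?_⟩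
    obtain ⟨b, hb⟩ := (Set.ne_univ_iff_exists_notMem Y).1 hY'
    refine (Set.ne_univ_iff_exists_notMem _).2 ⟨↑w⁻¹ * (b - c), ?_⟩
    simpa using hb
  obtain ⟨h₁, h₂⟩ := hpre 1 x₀ X hX hX'
  obtain ⟨M, hXM, hM', hM, habs⟩ := h₁.exists_absorbing h₂ hG hGc
  have h0 : (0 : R) ∈ M := hXM (by simpa using hx₀)
  have hsub : ∀ a ∈ M, ∀ b ∈ M, a - b ∈ M := by
    intro a ha b hb
    obtain ⟨k₁, k₂⟩ := hpre 1 b M hM hM'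
    exact habs _ k₁ k₂ ⟨0, h0, by simpa using hb⟩ (by simpa using ha)
  have hneg : ∀ a ∈ M, -a ∈ M := fun a ha => by simpa using hsub 0 h0 a ha
  have hadd : ∀ a ∈ M, ∀ b ∈ M, a + b ∈ M := fun a ha b hb => by
    simpa using hsub a ha _ (hneg b hb)
  have hmul : ∀ r : R, ∀ a ∈ M, r * a ∈ M := by
    intro r
    have hr : r ∈ AddSubgroup.closure {r : R | IsUnit r} := hunits ▸ AddSubgroup.mem_top r
    induction hr using AddSubgroup.closure_induction with
    | mem r hr =>
      intro a ha
      obtain ⟨w, rfl⟩ := hr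
      obtain ⟨k₁, k₂⟩ := hpre w⁻¹ 0 M hM hM'
      exact habs _ k₁ k₂ ⟨0, h0, by simpa using h0⟩ (by simpa using ha)
    | zero => intro a _; simpa using h0
    | add r s _ _ hr hs => intro a ha; rw [add_mul]; exact hadd _ (hr a ha) _ (hs a ha)
    | neg r _ hr => intro a ha; rw [neg_mul]; exact hneg _ (hr a ha)
  let I : Ideal R :=
    { carrier := M
      add_mem' := fun {a b} ha hb => hadd a ha b hb
      zero_mem' := h0
      smul_mem' := fun r a ha => hmul r a ha }
  have hI : (I : Set R) = M := rfl
  refine ⟨I, fun h => ?_, fun h => hM' (by rw [← hI, h]; rfl), hM⟩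
  have hmem : x₁ - x₀ ∈ I := hXM (by simpa using hx₁)
  rw [h, Ideal.mem_bot, sub_eq_zero] at hmem
  exact hne hmem.symm

end HomogeneousSets

theorem exists_dvd_forall_mk_mem_iff {F : Type} [Field F] {f : F[X]}
    (I : Ideal (AdjoinRoot f)) :
    ∃ g, g ∣ f ∧ ∀ p, AdjoinRoot.mk f p ∈ I ↔ g ∣ p := by
  obtain ⟨g, hg⟩ := (IsPrincipalIdealRing.principal (I.comap (AdjoinRoot.mk f))).principal
  have hmem : ∀ p, AdjoinRoot.mk f p ∈ I ↔ g ∣ p := fun p => by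
    rw [← Ideal.mem_comap, hg, ← Ideal.mem_span_singleton]
  exact ⟨g, (hmem f).1 (by simp), hmem⟩

section GcdGraph

variable {F : Type} [Field F] [DecidableEq F] {f p q : F[X]} {D : Finset F[X]}

theorem gcd_dvd_gcd_of_mk_eq_mul {r : AdjoinRoot f}
    (h : AdjoinRoot.mk f p = r * AdjoinRoot.mk f q) : gcd q f ∣ gcd p f := by
  obtain ⟨s, rfl⟩ := AdjoinRoot.mk_surjective r
  rw [← map_mul, AdjoinRoot.mk_eq_mk] at h
  refine dvd_gcd ?_ (gcd_dvd_right q f)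
  have := dvd_add ((gcd_dvd_right q f).trans h) ((gcd_dvd_left q f).mul_left s)
  rwa [sub_add_cancel] at this

theorem gcd_eq_gcd_of_mk_eq_unit_mul (w : (AdjoinRoot f)ˣ)
    (h : AdjoinRoot.mk f p = w * AdjoinRoot.mk f q) : gcd p f = gcd q f :=
  dvd_antisymm_of_normalize_eq (normalize_gcd _ _) (normalize_gcd _ _)
    (gcd_dvd_gcd_of_mk_eq_mul (r := ↑w⁻¹) (by simp [h])) (gcd_dvd_gcd_of_mk_eq_mul h)

theorem gcdGraph_adj_mk_iff :
    (gcdGraph f D).Adj (AdjoinRoot.mk f p) (AdjoinRoot.mk f q) ↔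
      AdjoinRoot.mk f p ≠ AdjoinRoot.mk f q ∧ gcd (p - q) f ∈ D := by
  rw [gcdGraph, SimpleGraph.fromRel_adj]
  refine and_congr_right fun _ => ⟨?_, fun h => Or.inl ⟨p - q, map_sub _ _ _, h⟩⟩
  rintro (⟨s, hs, hD⟩ | ⟨s, hs, hD⟩)
  · rwa [← gcd_eq_gcd_of_mk_eq_unit_mul (p := s) (q := p - q) 1 (by simp [hs])]
  · rwa [← gcd_eq_gcd_of_mk_eq_unit_mul (p := s) (q := p - q) (-1) (by simp [hs])]

theorem gcdGraph_adj_unit_mul_add_iff (w : (AdjoinRoot f)ˣ) (c u v : AdjoinRoot f) :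
    (gcdGraph f D).Adj (w * u + c) (w * v + c) ↔ (gcdGraph f D).Adj u v := by
  obtain ⟨p, rfl⟩ := AdjoinRoot.mk_surjective u
  obtain ⟨q, rfl⟩ := AdjoinRoot.mk_surjective v
  obtain ⟨a, rfl⟩ := AdjoinRoot.mk_surjective c
  obtain ⟨s, hs⟩ := AdjoinRoot.mk_surjective (w : AdjoinRoot f)
  rw [← hs, ← map_mul, ← map_mul, ← map_add, ← map_add, gcdGraph_adj_mk_iff,
    gcdGraph_adj_mk_iff, gcd_eq_gcd_of_mk_eq_unit_mul (p := s * p + a - (s * q + a))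
      (q := p - q) w (by rw [← hs, ← map_mul]; congr 1; ring)]
  simp [hs]

theorem isUnit_sub_of_gcdGraph_one_adj {u v : AdjoinRoot f}
    (h : (gcdGraph f {1}).Adj u v) : IsUnit (u - v) := by
  obtain ⟨p, rfl⟩ := AdjoinRoot.mk_surjective u
  obtain ⟨q, rfl⟩ := AdjoinRoot.mk_surjective v
  have hgcd : gcd (p - q) f = 1 := by simpa using (gcdGraph_adj_mk_iff.1 h).2
  obtain ⟨a, b, hab⟩ : IsCoprime (p - q) f :=
    (gcd_isUnit_iff _ _).1 (hgcd ▸ isUnit_one)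
  refine IsUnit.of_mul_eq_one (AdjoinRoot.mk f a) ?_
  rw [← map_sub, ← map_mul, ← map_one (AdjoinRoot.mk f), AdjoinRoot.mk_eq_mk]
  exact ⟨-b, by linear_combination hab⟩

theorem closure_isUnit_eq_top_of_gcdGraph_connected (h : (gcdGraph f {1}).Connected) :
    AddSubgroup.closure {r : AdjoinRoot f | IsUnit r} = ⊤ := by
  by_contra hne
  obtain ⟨x, hx, y, hy, hxy⟩ := h.exists_adj_mem_notMem
    (X := (AddSubgroup.closure {r : AdjoinRoot f | IsUnit r} : Set (AdjoinRoot f)))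
    ⟨0, zero_mem _⟩ (by simpa using hne)
  refine hy ?_
  have hyx : y - x ∈ AddSubgroup.closure {r : AdjoinRoot f | IsUnit r} :=
    AddSubgroup.subset_closure (isUnit_sub_of_gcdGraph_one_adj hxy)
  simpa using add_mem hyx hx

theorem dvd_of_isHomogeneousSet_ideal {g h d : F[X]} (hgh : IsCoprime g h)
    (hh : ¬ IsUnit h) {I : Ideal (AdjoinRoot (g * h))}
    (hI : ∀ p, AdjoinRoot.mk (g * h) p ∈ I ↔ g ∣ p)
    (hhom : IsHomogeneousSet (gcdGraph (g * h) D) (I : Set (AdjoinRoot (g * h))))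
    (hDdvd : ∀ d₁ ∈ D, ∀ d₂ ∈ D, d₁ ≠ d₂ → ¬ d₁ ∣ d₂)
    (hd : d ∈ D) (hdm : d.Monic) (hdvd : d ∣ g * h) : g ∣ d := by
  by_contra hgd
  have hdI : AdjoinRoot.mk (g * h) d ∉ (I : Set (AdjoinRoot (g * h))) :=
    fun hmem => hgd ((hI d).1 hmem)
  have hgcd : gcd d (g * h) = d :=
    dvd_antisymm_of_normalize_eq (normalize_gcd _ _) hdm.normalize_eq_self
      (gcd_dvd_left _ _) (dvd_gcd dvd_rfl hdvd)
  have hadj : (gcdGraph (g * h) D).Adj (AdjoinRoot.mk _ d) (AdjoinRoot.mk _ 0) :=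
    gcdGraph_adj_mk_iff.2 ⟨fun he => hdI (by rw [he]; simp), by simpa [hgcd] using hd⟩
  have hshift : ∀ s, gcd (d - g * s) (g * h) ∈ D := fun s =>
    (gcdGraph_adj_mk_iff.1 ((hhom.adj_iff hdI ((hI _).2 (dvd_zero g))
      ((hI _).2 (dvd_mul_right g s))).1 hadj)).2
  obtain ⟨a, b, hab⟩ := hgh
  set p := d - g * (a * (d - 1)) with hp
  set p' := d - g * (a * d) with hp'
  have hcop : IsCoprime p h := ⟨1, -(b * (d - 1)), by linear_combination (1 - d) * hab + hp⟩
  have hhp' : h ∣ p' := ⟨b * d, by linear_combination -d * hab + hp'⟩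
  have hcg : gcd p (g * h) ∣ g :=
    (hcop.of_isCoprime_of_dvd_left (gcd_dvd_left _ _)).dvd_of_dvd_mul_right (gcd_dvd_right _ _)
  have hcp' : gcd p (g * h) ∣ p' := by
    have : p' = p - g * a := by rw [hp, hp']; ring
    rw [this]
    exact dvd_sub (gcd_dvd_left _ _) (hcg.mul_right a)
  refine hDdvd _ (hshift (a * (d - 1))) _ (hshift (a * d)) (fun he => hh ?_)
    (dvd_gcd hcp' (gcd_dvd_right _ _))
  exact hcop.isUnit_of_dvd' (((dvd_gcd hhp' (dvd_mul_left h g)).trans he.symm.dvd).trans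
    (gcd_dvd_left _ _)) dvd_rfl

end GcdGraph

/-- For squarefree `f` with `G_f({1})` connected, if the elements of `D` are pairwise
non-dividing and `G_f(D)` is connected and anti-connected, then `G_f(D)` is prime. -/
theorem gcdGraph_prime
    (f : Polynomial Fq) (hf : f.Monic) (hdeg : 0 < f.natDegree) (hsq : Squarefree f)
    (hunit : (gcdGraph f {1}).Connected)
    (D : Finset (Polynomial Fq)) (hD : ∀ d ∈ D, d.Monic ∧ d ∣ f ∧ d ≠ f)
    (hDdvd : ∀ d₁ ∈ D, ∀ d₂ ∈ D, d₁ ≠ d₂ → ¬ d₁ ∣ d₂)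
    (hconn : (gcdGraph f D).Connected)
    (hanti : (gcdGraph f D)ᶜ.Connected) :
    IsPrimeGraph (gcdGraph f D) := by
  rintro ⟨X, hX₂, hXlt, hX⟩
  have : Finite (AdjoinRoot f) := Nat.finite_of_card_ne_zero (by omega)
  have hX' : X ≠ Set.univ := by
    rintro rfl
    simp at hXlt
  obtain ⟨I, hbot, htop, hI⟩ := hX.exists_ideal gcdGraph_adj_unit_mul_add_iff
    (closure_isUnit_eq_top_of_gcdGraph_connected hunit) hconn hanti hX'
    ((Set.one_lt_ncard_iff_nontrivial).1 hX₂)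
  obtain ⟨g, ⟨h, rfl⟩, hg⟩ := exists_dvd_forall_mk_mem_iff I
  have hh : ¬ IsUnit h := by
    refine fun hu => hbot ((Submodule.eq_bot_iff I).2 fun r hr => ?_)
    obtain ⟨p, rfl⟩ := AdjoinRoot.mk_surjective r
    rw [AdjoinRoot.mk_eq_zero]
    exact hu.mul_right_dvd.2 ((hg p).1 hr)
  obtain ⟨x, hx, y, hy, hxy⟩ := hconn.exists_adj_mem_notMem (X := (I : Set _))
    ⟨0, I.zero_mem⟩ (by simpa using htop)
  obtain ⟨p, rfl⟩ := AdjoinRoot.mk_surjective x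
  obtain ⟨q, rfl⟩ := AdjoinRoot.mk_surjective y
  have hmem := (gcdGraph_adj_mk_iff.1 hxy).2
  have hgd := dvd_of_isHomogeneousSet_ideal (squarefree_mul_iff.1 hsq).1.isCoprime hh hg hI
    hDdvd hmem (hD _ hmem).1 (hD _ hmem).2.1
  refine hy ((hg q).2 ?_)
  exact (dvd_sub_left ((hg p).1 hx)).1 (hgd.trans (gcd_dvd_left _ _))
end

section
/- Let 𝔽_q have characteristic p, let f ∈ 𝔽_q[x] be a nonconstant monic polynomial, and let ψ : 𝔽_q[x]/(f) → 𝔽_q be a non-degenerate 𝔽_q-linear functional. Fix a primitive p-th root of unity ζ_p ∈ ℂ. Then the Ramanujan sum c_ψ(1, f) = Σ_{a ∈ (𝔽_q[x]/(f))^×} ζ_p^{Tr(ψ(a))} equals μ(f): that is, it equals 0 if f is not squarefree, and (−1)^{ω(f)} if f is squarefree, where ω(f) is the number of distinct monic irreducible factors of f. -/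
open Polynomial

variable {Fq : Type} [Field Fq] [Fintype Fq] [DecidableEq Fq]

/-- `ω(h)`: the number of distinct monic irreducible factors of `h`. -/
noncomputable def omegaPoly (h : Polynomial Fq) : ℕ :=
  Nat.card {π : Polynomial Fq // π.Monic ∧ Irreducible π ∧ π ∣ h}

open Classical in
/-- The Möbius function of a monic polynomial: `0` if not squarefree,
`(−1)^{ω(h)}` if squarefree. -/
noncomputable def muPoly (h : Polynomial Fq) : ℤ :=
  if Squarefree h then (-1) ^ omegaPoly h else 0

section AbstractUnitSum

open Classical in
lemma isUnit_indicator_eq_sum {R ι : Type*} [CommRing R] [Fintype ι]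
    (m : ι → Ideal R) (hunit : ∀ r, IsUnit r ↔ ∀ i, r ∉ m i) (r : R) [Decidable (IsUnit r)] :
    (if IsUnit r then (1 : ℂ) else 0) =
      ∑ S : Finset ι, (-1) ^ S.card * (if r ∈ S.inf m then 1 else 0) := by
  have hprod : (if IsUnit r then (1 : ℂ) else 0)
      = ∏ i, (1 + -(if r ∈ m i then (1 : ℂ) else 0)) := by
    by_cases h : IsUnit r
    · rw [if_pos h]
      simp [(hunit r).1 h]
    · rw [if_neg h]
      obtain ⟨i, hi⟩ := not_forall.1 (mt (hunit r).2 h)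
      exact (Finset.prod_eq_zero (Finset.mem_univ i) (by simp [not_not.1 hi])).symm
  rw [hprod, Finset.prod_one_add, Finset.powerset_univ]
  refine Finset.sum_congr rfl fun S _ => ?_
  rw [Finset.prod_neg, Finset.prod_ite_zero]
  simp [Submodule.mem_finsetInf]

open Classical in
lemma AddChar.sum_ideal_eq_ite {R : Type*} [CommRing R] [Fintype R]
    (χ : AddChar R ℂ) (hχ : ∀ I : Ideal R, (∀ a ∈ I, χ a = 1) → I = ⊥) (I : Ideal R) :
    ∑ r : R, (if r ∈ I then χ r else 0) = if I = ⊥ then 1 else 0 := by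
  split_ifs with hI
  · simp [hI]
  · rw [← Finset.sum_filter, Finset.sum_subtype (p := (· ∈ I)) _ (by simp)]
    refine AddChar.sum_eq_zero_of_ne_one
      (ψ := χ.compAddMonoidHom (I.subtype : I →ₗ[R] R).toAddMonoidHom) fun h => hI (hχ I ?_)
    intro a ha
    exact DFunLike.congr_fun h (⟨a, ha⟩ : I)

lemma finset_inf_eq_bot_iff {R ι : Type*} [CommRing R] [Finite R] [Fintype ι]
    (m : ι → Ideal R) (hprime : ∀ i, (m i).IsPrime) (hanti : ∀ i j, m i ≤ m j → i = j)
    (hunit : ∀ r, IsUnit r ↔ ∀ i, r ∉ m i) (S : Finset ι) :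
    S.inf m = ⊥ ↔ S = Finset.univ ∧ IsReduced R := by
  constructor
  · intro h
    have hS : S = Finset.univ := by
      refine Finset.eq_univ_of_forall fun j => ?_
      obtain ⟨i, hi, hij⟩ := (hprime j).inf_le'.1 (h.trans_le bot_le)
      exact hanti i j hij ▸ hi
    refine ⟨hS, ⟨fun x hx => ?_⟩⟩
    rw [← Ideal.mem_bot, ← h, Submodule.mem_finsetInf]
    obtain ⟨n, hn⟩ := hx
    exact fun i _ => (hprime i).mem_of_pow_mem n (hn ▸ (m i).zero_mem)
  · rintro ⟨rfl, hR⟩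
    refine (Submodule.eq_bot_iff _).2 fun x hx => ?_
    rw [Submodule.mem_finsetInf] at hx
    have hjac : x ∈ (⊥ : Ideal R).jacobson := by
      refine Ideal.mem_jacobson_bot.2 fun y => (hunit _).2 fun i hi => ?_
      refine (hprime i).ne_top ((Ideal.eq_top_iff_one _).2 ?_)
      exact ((m i).add_mem_iff_right ((m i).mul_mem_right y (hx i (Finset.mem_univ i)))).1 hi
    obtain ⟨n, hn⟩ := IsArtinianRing.isNilpotent_jacobson_bot (R := R)
    have hx' : x ^ n ∈ (⊥ : Ideal R).jacobson ^ n := Ideal.pow_mem_pow hjac n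
    rw [hn] at hx'
    exact IsReduced.eq_zero x ⟨n, by simpa using hx'⟩

open Classical in
/-- The sum over the units of a finite commutative ring of an additive character that is
nontrivial on every nonzero ideal; `m` enumerates the maximal ideals. -/
theorem AddChar.sum_units_eq_ite_isReduced {R ι : Type*} [CommRing R] [Fintype R] [Fintype Rˣ]
    [Fintype ι] (m : ι → Ideal R) (hprime : ∀ i, (m i).IsPrime)
    (hanti : ∀ i j, m i ≤ m j → i = j) (hunit : ∀ r, IsUnit r ↔ ∀ i, r ∉ m i)
    (χ : AddChar R ℂ) (hχ : ∀ I : Ideal R, (∀ a ∈ I, χ a = 1) → I = ⊥) :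
    ∑ u : Rˣ, χ u = if IsReduced R then (-1) ^ Fintype.card ι else 0 := by
  have hsum : ∑ u : Rˣ, χ u = ∑ r : R, (if IsUnit r then (1 : ℂ) else 0) * χ r := by
    simp only [ite_mul, one_mul, zero_mul]
    rw [← Finset.sum_filter]
    refine Finset.sum_bij (fun u _ => (u : R)) (by simp) (fun _ _ _ _ h => Units.ext h) ?_ (by simp)
    intro r hr
    obtain ⟨u, rfl⟩ := (Finset.mem_filter.1 hr).2
    exact ⟨u, Finset.mem_univ u, rfl⟩
  simp only [hsum, isUnit_indicator_eq_sum m hunit, Finset.sum_mul]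
  rw [Finset.sum_comm]
  simp only [mul_assoc, ite_mul, one_mul, zero_mul]
  simp only [← Finset.mul_sum, AddChar.sum_ideal_eq_ite χ hχ,
    finset_inf_eq_bot_iff m hprime hanti hunit]
  by_cases hR : IsReduced R <;> simp [hR]

end AbstractUnitSum

section AdjoinRoot

lemma AdjoinRoot.mk_dvd_mk_iff {K : Type*} [CommRing K] {f π : K[X]} (hπ : π ∣ f) (g : K[X]) :
    AdjoinRoot.mk f π ∣ AdjoinRoot.mk f g ↔ π ∣ g := by
  refine ⟨?_, map_dvd _⟩
  rintro ⟨c, hc⟩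
  obtain ⟨c, rfl⟩ := AdjoinRoot.mk_surjective c
  rw [← map_mul, AdjoinRoot.mk_eq_mk] at hc
  exact (dvd_sub_left (dvd_mul_right π c)).1 (hπ.trans hc)

lemma AdjoinRoot.isPrime_span_mk {K : Type*} [Field K] {f π : K[X]} (hirr : Irreducible π)
    (hπ : π ∣ f) : (Ideal.span {AdjoinRoot.mk f π}).IsPrime := by
  constructor
  · rw [Ne, Ideal.eq_top_iff_one, Ideal.mem_span_singleton, ← map_one (AdjoinRoot.mk f),
      AdjoinRoot.mk_dvd_mk_iff hπ]
    exact fun h => hirr.not_isUnit (isUnit_of_dvd_one h)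
  · intro x y
    obtain ⟨x, rfl⟩ := AdjoinRoot.mk_surjective x
    obtain ⟨y, rfl⟩ := AdjoinRoot.mk_surjective y
    simp only [← map_mul, Ideal.mem_span_singleton, AdjoinRoot.mk_dvd_mk_iff hπ]
    exact hirr.prime.dvd_or_dvd

lemma AdjoinRoot.isUnit_of_forall_irreducible {K : Type*} [Field K] {f : K[X]} (r : AdjoinRoot f)
    (h : ∀ π : K[X], π.Monic → Irreducible π → π ∣ f → ¬ AdjoinRoot.mk f π ∣ r) : IsUnit r := by
  classical
  obtain ⟨g, rfl⟩ := AdjoinRoot.mk_surjective r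
  have hcop : IsCoprime f g := by
    rw [← EuclideanDomain.gcd_isUnit_iff]
    by_contra hn
    obtain ⟨π, hm, hirr, hdvd⟩ := Polynomial.exists_monic_irreducible_factor _ hn
    exact h π hm hirr (hdvd.trans (EuclideanDomain.gcd_dvd_left f g))
      (map_dvd _ (hdvd.trans (EuclideanDomain.gcd_dvd_right f g)))
  obtain ⟨a, b, hab⟩ := hcop
  refine IsUnit.of_mul_eq_one (AdjoinRoot.mk f b) ?_
  simpa [mul_comm] using congrArg (AdjoinRoot.mk f) hab

lemma AdjoinRoot.isReduced_iff_squarefree {K : Type*} [Field K] {f : K[X]} (hf : f ≠ 0) :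
    IsReduced (AdjoinRoot f) ↔ Squarefree f := by
  rw [← isRadical_iff_squarefree_of_ne_zero hf, isRadical_iff_span_singleton,
    Ideal.isRadical_iff_quotient_reduced]
  rfl

end AdjoinRoot

/-- The Ramanujan sum `c_ψ(1, f) = Σ_{a ∈ (𝔽_q[x]/(f))^×} ζ_p^{Tr(ψ(a))}` equals `μ(f)`,
for any non-degenerate `𝔽_q`-linear functional `ψ` on `𝔽_q[x]/(f)`. -/
theorem ramanujan_sum_one_eq_moebius
    (p : ℕ) (hp : p.Prime) [CharP Fq p] [Algebra (ZMod p) Fq]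
    (f : Polynomial Fq) (hf : f.Monic) (hdeg : 0 < f.natDegree)
    [Fintype (AdjoinRoot f)ˣ]
    (ψ : AdjoinRoot f →ₗ[Fq] Fq)
    (hψ : ∀ I : Ideal (AdjoinRoot f), (∀ a ∈ I, ψ a = 0) → I = ⊥)
    (ζ : ℂ) (hζ : IsPrimitiveRoot ζ p) :
    ∑ a : (AdjoinRoot f)ˣ, ζ ^ (Algebra.trace (ZMod p) Fq (ψ (a : AdjoinRoot f))).val =
      (muPoly f : ℂ) := by
  classical
  have : Fact p.Prime := ⟨hp⟩
  have := hf.finite_adjoinRoot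
  have : Finite (AdjoinRoot f) := Module.finite_of_finite Fq
  let _ := Fintype.ofFinite (AdjoinRoot f)
  let ι := {π : Fq[X] // π.Monic ∧ Irreducible π ∧ π ∣ f}
  let m : ι → Ideal (AdjoinRoot f) := fun π => Ideal.span {AdjoinRoot.mk f π}
  have hprime : ∀ i, (m i).IsPrime := fun i => AdjoinRoot.isPrime_span_mk i.2.2.1 i.2.2.2
  have hanti : ∀ i j, m i ≤ m j → i = j := by
    intro i j hij
    rw [Ideal.span_singleton_le_span_singleton, AdjoinRoot.mk_dvd_mk_iff j.2.2.2] at hij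
    exact Subtype.ext (Polynomial.eq_of_monic_of_associated i.2.1 j.2.1
      (j.2.2.1.associated_of_dvd i.2.2.1 hij).symm)
  have hunit : ∀ r, IsUnit r ↔ ∀ i, r ∉ m i := by
    refine fun r => ⟨fun hr i hi => (hprime i).ne_top (Ideal.eq_top_of_isUnit_mem _ hi hr),
      fun h => AdjoinRoot.isUnit_of_forall_irreducible r fun π hm hirr hπ hdvd => ?_⟩
    exact h ⟨π, hm, hirr, hπ⟩ (Ideal.mem_span_singleton.2 hdvd)
  have : Finite ι := Finite.of_injective m fun i j h => hanti i j h.le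
  let _ := Fintype.ofFinite ι
  let χ : AddChar (AdjoinRoot f) ℂ := (AddChar.zmodChar p hζ.pow_eq_one).compAddMonoidHom
    ((Algebra.trace (ZMod p) Fq).toAddMonoidHom.comp ψ.toAddMonoidHom)
  have hχ_apply : ∀ a, χ a = ζ ^ (Algebra.trace (ZMod p) Fq (ψ a)).val := fun a =>
    AddChar.zmodChar_apply hζ.pow_eq_one _
  have hχ : ∀ I : Ideal (AdjoinRoot f), (∀ a ∈ I, χ a = 1) → I = ⊥ := by
    refine fun I hI => hψ I fun a ha => ?_
    by_contra hne
    obtain ⟨c, hc⟩ := Algebra.trace_surjective (ZMod p) Fq 1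
    have h := hI ((c / ψ a) • a) (Submodule.smul_of_tower_mem I _ ha)
    rw [hχ_apply, map_smul, smul_eq_mul, div_mul_cancel₀ _ hne, hc,
      hζ.pow_eq_one_iff_dvd, ZMod.val_one] at h
    exact hp.one_lt.ne' (Nat.dvd_one.1 h)
  have key := AddChar.sum_units_eq_ite_isReduced m hprime hanti hunit χ hχ
  simp only [hχ_apply] at key
  rw [key, AdjoinRoot.isReduced_iff_squarefree hf.ne_zero, muPoly, omegaPoly,
    Nat.card_eq_fintype_card]
  push_cast
  rfl
end

section
/- Let 𝔽_q have characteristic p and let f ∈ 𝔽_q[x] be a nonconstant monic polynomial. Let S be a subset of 𝔽_q[x]/(f) with S = −S, 0 ∉ S, and k·S = S for every k ∈ 𝔽_p^× (scalar multiplication by nonzero elements of the prime field). Then every eigenvalue of the adjacency matrix (over ℂ) of the Cayley graph Γ(𝔽_q[x]/(f), S) is an integer. -/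
open Polynomial

/-- A complex function on a finite abelian group that is orthogonal to every additive character
vanishes. -/
theorem eq_zero_of_sum_mul_addChar_eq_zero {G : Type*} [AddCommGroup G] [Fintype G]
    (v : G → ℂ) (h : ∀ ψ : AddChar G ℂ, ∑ u, v u * ψ u = 0) : v = 0 := by
  classical
  have hφ : Fintype.linearCombination ℂ v = 0 := by
    refine (AddChar.complexBasis G).ext fun ψ => ?_
    simpa [Fintype.linearCombination_apply, mul_comm] using h ψ
  funext u
  simpa using LinearMap.congr_fun hφ (Pi.single u 1)

/-- A nonzero eigenvector of the convolution operator of `T` forces the eigenvalue to be a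
character sum over `T`. -/
theorem exists_addChar_sum_eq_of_eigenvector {G : Type*} [AddCommGroup G] [Fintype G]
    [DecidableEq G] (T : Finset G) (v : G → ℂ) (hv : v ≠ 0) (μ : ℂ)
    (h : ∀ u, ∑ w, (if u - w ∈ T then v w else 0) = μ * v u) :
    ∃ ψ : AddChar G ℂ, μ = ∑ s ∈ T, ψ s := by
  obtain ⟨ψ, hψ⟩ : ∃ ψ : AddChar G ℂ, ∑ u, v u * ψ u ≠ 0 := by
    by_contra! H
    exact hv (eq_zero_of_sum_mul_addChar_eq_zero v H)
  refine ⟨ψ, mul_right_cancel₀ hψ ?_⟩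
  have hshift (w : G) : ∑ u, (if u - w ∈ T then ψ u else 0) = (∑ s ∈ T, ψ s) * ψ w := by
    rw [← Equiv.sum_comp (Equiv.addRight w)]
    simp [AddChar.map_add_eq_mul, Finset.sum_mul]
  calc μ * ∑ u, v u * ψ u = ∑ u, (μ * v u) * ψ u := by simp [Finset.mul_sum, mul_assoc]
    _ = ∑ u, ∑ w, v w * (if u - w ∈ T then ψ u else 0) := by
      simp [← h, Finset.sum_mul]
    _ = ∑ w, v w * ((∑ s ∈ T, ψ s) * ψ w) := by
      rw [Finset.sum_comm]
      simp only [← Finset.mul_sum, hshift]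
    _ = (∑ s ∈ T, ψ s) * ∑ w, v w * ψ w := by
      rw [Finset.mul_sum]
      exact Finset.sum_congr rfl fun w _ => by ring

/-- The sum of the first `p` powers of a `p`-th root of unity. -/
theorem sum_range_pow_of_pow_eq_one {K : Type*} [Field K] [DecidableEq K] {p : ℕ} {z : K}
    (hz : z ^ p = 1) : ∑ i ∈ Finset.range p, z ^ i = if z = 1 then (p : K) else 0 := by
  split_ifs with h
  · simp [h]
  · rw [geom_sum_eq h, hz, sub_self, zero_div]

/-- A complex algebraic integer with a nonzero integer multiple in `ℤ` is an integer. -/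
theorem exists_int_eq_of_isIntegral_of_mul_eq {μ : ℂ} (hμ : IsIntegral ℤ μ) {a b : ℤ}
    (ha : a ≠ 0) (h : (a : ℂ) * μ = b) : ∃ n : ℤ, μ = n := by
  have hq : μ = algebraMap ℚ ℂ (b / a) := by
    have : (a : ℂ) ≠ 0 := by exact_mod_cast ha
    simp [← h, this]
  rw [hq, isIntegral_algebraMap_iff (algebraMap ℚ ℂ).injective] at hμ
  obtain ⟨n, hn⟩ := IsIntegrallyClosed.isIntegral_iff.mp hμ
  exact ⟨n, by rw [hq, ← hn]; simp⟩

/-- Character sums over a subset of an elementary abelian `p`-group that is stable under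
multiplication by `1, …, p - 1` are integers. -/
theorem exists_int_eq_sum_addChar {G : Type*} [AddCommGroup G] [DecidableEq G] {p : ℕ}
    (hp : p.Prime) (hG : ∀ g : G, p • g = 0) (T : Finset G)
    (hT : ∀ i, 0 < i → i < p → T.image (fun s => i • s) = T) (ψ : AddChar G ℂ) :
    ∃ n : ℤ, ∑ s ∈ T, ψ s = n := by
  classical
  have hroot (s : G) : ψ s ^ p = 1 := by
    rw [← AddChar.map_nsmul_eq_pow, hG, AddChar.map_zero_eq_one]
  have hint : IsIntegral ℤ (∑ s ∈ T, ψ s) :=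
    IsIntegral.sum _ fun s _ => .of_pow hp.pos (by rw [hroot]; exact isIntegral_one)
  have hpow {i : ℕ} (hi : 0 < i) (hip : i < p) : ∑ s ∈ T, ψ s ^ i = ∑ s ∈ T, ψ s := by
    have hinj : Set.InjOn (fun s : G => i • s) (T : Set G) :=
      Finset.card_image_iff.mp (by rw [hT i hi hip])
    conv_rhs => rw [← hT i hi hip]
    rw [Finset.sum_image hinj]
    simp [AddChar.map_nsmul_eq_pow]
  have hsum : ∑ i ∈ Finset.range p, ∑ s ∈ T, ψ s ^ i =
      (p : ℂ) * (T.filter fun s => ψ s = 1).card := by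
    rw [Finset.sum_comm]
    simp [sum_range_pow_of_pow_eq_one (hroot _), ← Finset.sum_filter, mul_comm]
  obtain ⟨m, rfl⟩ : ∃ m, p = m + 1 := ⟨p - 1, (Nat.sub_add_cancel hp.pos).symm⟩
  rw [Finset.sum_range_succ', Finset.sum_congr rfl fun i hi =>
    hpow i.succ_pos (Nat.succ_lt_succ (Finset.mem_range.mp hi))] at hsum
  refine exists_int_eq_of_isIntegral_of_mul_eq hint (a := m)
    (b := (m + 1) * (T.filter fun s => ψ s = 1).card - T.card) ?_ ?_
  · have := hp.two_le
    omega
  · simp only [Finset.sum_const, Finset.card_range, nsmul_eq_mul, pow_zero, mul_one] at hsum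
    push_cast at hsum ⊢
    linear_combination hsum

/-- If `S ⊆ 𝔽_q[x]/(f)` is symmetric, avoids `0`, and is stable under scalar multiplication
by the nonzero elements of the prime field `𝔽_p`, then all eigenvalues of the adjacency
matrix of the Cayley graph `Γ(𝔽_q[x]/(f), S)` are integers. -/
theorem cayley_integral_spectrum
    {Fq : Type} [Field Fq] [Fintype Fq] [DecidableEq Fq]
    (p : ℕ) (hp : p.Prime) [CharP Fq p]
    (f : Polynomial Fq) (hf : f.Monic) (hdeg : 0 < f.natDegree)
    (S : Set (AdjoinRoot f))
    (hzero : (0 : AdjoinRoot f) ∉ S)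
    (hsymm : ∀ s ∈ S, -s ∈ S)
    (hscale : ∀ k : (ZMod p)ˣ,
      (fun s : AdjoinRoot f => (((k : ZMod p).val : AdjoinRoot f)) * s) '' S = S)
    [Fintype (AdjoinRoot f)]
    [DecidableRel (SimpleGraph.fromRel fun u v : AdjoinRoot f => u - v ∈ S).Adj] :
    ∀ μ : ℂ,
      (∃ v : AdjoinRoot f → ℂ, v ≠ 0 ∧
        ((SimpleGraph.fromRel fun u v : AdjoinRoot f => u - v ∈ S).adjMatrix ℂ).mulVec v =
          μ • v) →
      ∃ n : ℤ, μ = (n : ℂ) := by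
  classical
  rintro μ ⟨v, hv, h⟩
  have hadj (u w : AdjoinRoot f) :
      (SimpleGraph.fromRel fun u v : AdjoinRoot f => u - v ∈ S).Adj u w ↔ u - w ∈ S := by
    rw [SimpleGraph.fromRel_adj]
    refine ⟨?_, fun hS => ⟨?_, .inl hS⟩⟩
    · rintro ⟨-, hS | hS⟩
      · exact hS
      · simpa using hsymm _ hS
    · rintro rfl
      exact hzero (by simpa using hS)
  obtain ⟨ψ, rfl⟩ := exists_addChar_sum_eq_of_eigenvector S.toFinset v hv μ fun u => by
    have hu := congrFun h u
    simp only [Matrix.mulVec, dotProduct, SimpleGraph.adjMatrix_apply, hadj] at hu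
    simpa using hu
  have hpzero : (p : AdjoinRoot f) = 0 := by
    rw [← map_natCast (AdjoinRoot.of f), CharP.cast_eq_zero, map_zero]
  refine exists_int_eq_sum_addChar hp (fun g => by rw [nsmul_eq_mul, hpzero, zero_mul]) _
    (fun i hi hip => ?_) ψ
  have : Fact p.Prime := ⟨hp⟩
  have hne : (i : ZMod p) ≠ 0 := by
    rw [Ne, ZMod.natCast_eq_zero_iff]
    exact Nat.not_dvd_of_pos_of_lt hi hip
  have hk := hscale (Units.mk0 _ hne)
  rw [Units.val_mk0, ZMod.val_natCast_of_lt hip] at hk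
  apply Finset.coe_injective
  simpa [nsmul_eq_mul] using hk
end
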